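/- arXiv:2510.26059 — 7 statements merged into one kernel-verified Lean document; each statement's English description precedes it below -/
import Mathlib

section
/- For every σ > 0, every s > 0 and every θ ∈ ℝ, the absolutely convergent series Σ_{k∈ℤ} sin(π|k|/σ) e^{−|k|s/σ} e^{−ikθ/σ} equals (1/2)·sin((π−θ)/σ)/(cosh(s/σ) − cos((π−θ)/σ)) + (1/2)·sin((π+θ)/σ)/(cosh(s/σ) − cos((π+θ)/σ)). -/
open MeasureTheory Real Set
open scoped ENNReal NNReal

noncomputable section

/-- The measure `r dr` on `(0,∞)`. -/
def radialMeasure : Measure ℝ :=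
  (volume.restrict (Set.Ioi (0:ℝ))).withDensity fun r => ENNReal.ofReal r

/-- The measure `r dr dθ` on the flat cone `X = (0,∞) × [0, 2πσ)`. -/
def coneMeasure (σ : ℝ) : Measure (ℝ × ℝ) :=
  radialMeasure.prod (volume.restrict (Set.Ico (0:ℝ) (2*π*σ)))

/-- The integral operator on the flat cone associated with a kernel `K`. -/
def coneOp (σ : ℝ) (K : ℝ → ℝ → ℝ → ℝ → ℂ) (f : ℝ × ℝ → ℂ) : ℝ × ℝ → ℂ :=
  fun x => ∫ θ₂ in Set.Ico (0:ℝ) (2*π*σ), ∫ r₂ in Set.Ioi (0:ℝ),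
    K x.1 x.2 r₂ θ₂ * f (r₂, θ₂) * (r₂:ℂ)

/-- The critical Bochner–Riesz exponent `δ_c(p,2) = max {0, 2|1/2 − 1/p| − 1/2}`. -/
def deltaC (p : ℝ≥0∞) : ℝ := max 0 (2 * |1/2 - (1/p).toReal| - 1/2)

/-- `d_j(r₁,r₂,θ) = sqrt(r₁² + r₂² − 2 r₁ r₂ cos(θ + 2jσπ))`. -/
def dj (σ : ℝ) (j : ℤ) (r₁ r₂ θ : ℝ) : ℝ :=
  Real.sqrt (r₁^2 + r₂^2 - 2*r₁*r₂*Real.cos (θ + 2*(j:ℝ)*σ*π))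

/-- `d_s(r₁,r₂) = sqrt(r₁² + r₂² + 2 r₁ r₂ cosh s)`. -/
def dsc (s r₁ r₂ : ℝ) : ℝ := Real.sqrt (r₁^2 + r₂^2 + 2*r₁*r₂*Real.cosh s)

/-- The diffractive density `A_σ(s,θ)`. -/
def Asig (σ s θ : ℝ) : ℝ :=
  (1/2) * (Real.sin ((π - θ)/σ) / (Real.cosh (s/σ) - Real.cos ((π - θ)/σ)))
  + (1/2) * (Real.sin ((π + θ)/σ) / (Real.cosh (s/σ) - Real.cos ((π + θ)/σ)))

/-- A symbol of order `0` with constants `Cn`: smooth on `(0,∞)` with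
`|a^{(n)}(r)| ≤ Cn n (1+r)^{-n}`. -/
def IsSymbol0 (a : ℝ → ℂ) (Cn : ℕ → ℝ) : Prop :=
  ContDiffOn ℝ (⊤ : ℕ∞) a (Set.Ioi 0) ∧
  ∀ n : ℕ, ∀ r : ℝ, 0 < r →
    ‖iteratedDerivWithin n a (Set.Ioi 0) r‖ ≤ Cn n * (1 + r) ^ (-(n:ℝ))

/-- Littlewood–Paley-type pieces: `ψ_k = ψ(2^{-k}·)` for `k ≥ 1` and
`ψ₀ = 1 − Σ_{m≥1} ψ(2^{-m}·)` for `k = 0`. -/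
def psiK (ψ : ℝ → ℝ) (k : ℕ) (r : ℝ) : ℝ :=
  if k = 0 then 1 - ∑' m : ℕ, ψ (r / 2^(m+1)) else ψ (r / 2^k)

lemma norm_exp_neg_add_ofReal_mul_I_lt_one {a : ℝ} (ha : 0 < a) (b : ℝ) :
    ‖Complex.exp (-a + b * Complex.I)‖ < 1 := by
  rw [Complex.norm_exp]
  simpa using ha

/-- One half of the series, as a difference of two geometric series. -/
lemma hasSum_sin_mul_exp_mul_cexp {a : ℝ} (ha : 0 < a) (p τ : ℝ) :
    HasSum (fun n : ℕ => ((Real.sin (n * p) * Real.exp (-(n * a)) : ℝ) : ℂ) *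
        Complex.exp (-Complex.I * ((n * τ : ℝ) : ℂ)))
      (((1 - Complex.exp (-a + (p - τ : ℝ) * Complex.I))⁻¹
        - (1 - Complex.exp (-a + (-(p + τ) : ℝ) * Complex.I))⁻¹) / (2 * Complex.I)) := by
  have h₁ := hasSum_geometric_of_norm_lt_one
    (norm_exp_neg_add_ofReal_mul_I_lt_one ha (p - τ))
  have h₂ := hasSum_geometric_of_norm_lt_one
    (norm_exp_neg_add_ofReal_mul_I_lt_one ha (-(p + τ)))
  convert! (h₁.sub h₂).div_const (2 * Complex.I) using 1
  funext n
  rw [← Complex.exp_nat_mul, ← Complex.exp_nat_mul]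
  have e₁ : (n : ℂ) * (-a + (p - τ : ℝ) * Complex.I)
      = (n * p) * Complex.I + -(n * a) + -Complex.I * (n * τ) := by
    push_cast; ring
  have e₂ : (n : ℂ) * (-a + (-(p + τ) : ℝ) * Complex.I)
      = -(n * p) * Complex.I + -(n * a) + -Complex.I * (n * τ) := by
    push_cast; ring
  rw [e₁, e₂]
  simp only [Complex.exp_add]
  push_cast
  rw [Complex.sin, eq_div_iff (mul_ne_zero two_ne_zero Complex.I_ne_zero)]
  linear_combination ((Complex.exp (-(n * p) * Complex.I) - Complex.exp (n * p * Complex.I)) *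
    Complex.exp (-(n * a)) * Complex.exp (-Complex.I * (n * τ))) * Complex.I_sq

/-- The conjugate Poisson kernel in hyperbolic form. -/
lemma inv_one_sub_exp_sub_inv_one_sub_exp {a : ℝ} (ha : 0 < a) (b : ℝ) :
    ((1 - Complex.exp (-a + b * Complex.I))⁻¹
        - (1 - Complex.exp (-a + (-b : ℝ) * Complex.I))⁻¹) / (2 * Complex.I)
      = (((1/2) * (Real.sin b / (Real.cosh a - Real.cos b)) : ℝ) : ℂ) := by
  have ne_one (b : ℝ) : 1 - Complex.exp (-a + b * Complex.I) ≠ 0 := fun h => by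
    have := norm_exp_neg_add_ofReal_mul_I_lt_one ha b
    rw [← sub_eq_zero.1 h] at this
    simp at this
  have h₁ := ne_one b
  have h₂ := ne_one (-b)
  push_cast at h₂ ⊢
  rw [Complex.exp_add] at h₁ h₂ ⊢
  rw [Complex.exp_add]
  have hE : Complex.exp (b * Complex.I) * Complex.exp (-b * Complex.I) = 1 := by
    rw [← Complex.exp_add]; simp
  have hQ : Complex.exp a * Complex.exp (-a) = 1 := by
    rw [← Complex.exp_add]; simp
  rw [Complex.cosh, Complex.cos, Complex.sin]
  generalize Complex.exp (b * Complex.I) = E at *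
  generalize Complex.exp (-b * Complex.I) = F at *
  generalize Complex.exp (a : ℂ) = Q at *
  generalize Complex.exp (-a : ℂ) = R at *
  have key : (Q + R) / 2 - (E + F) / 2 = Q * ((1 - R * E) * (1 - R * F)) / 2 := by
    linear_combination (-(1/2) * R * R * Q) * hE + ((E + F) / 2 - R / 2) * hQ
  have hQ0 : Q ≠ 0 := left_ne_zero_of_mul_eq_one hQ
  rw [key]
  field_simp
  linear_combination (E - F) * hQ + (E - F) * Complex.I_sq

/-- for `σ, s > 0` the series `Σ_{k∈ℤ} sin(π|k|/σ) e^{−|k|s/σ} e^{−ikθ/σ}`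
converges absolutely and equals `A_σ(s,θ)`. -/
theorem diffractive_series_eq (σ s θ : ℝ) (hσ : 0 < σ) (hs : 0 < s) :
    (Summable fun k : ℤ =>
      ((Real.sin (π * |(k:ℝ)| / σ) * Real.exp (-(|(k:ℝ)| * s) / σ) : ℝ) : ℂ) *
        Complex.exp (-Complex.I * ((k:ℝ) * θ / σ : ℝ))) ∧
    (∑' k : ℤ,
      ((Real.sin (π * |(k:ℝ)| / σ) * Real.exp (-(|(k:ℝ)| * s) / σ) : ℝ) : ℂ) *
        Complex.exp (-Complex.I * ((k:ℝ) * θ / σ : ℝ)))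
      = ((Asig σ s θ : ℝ) : ℂ) := by
  set f : ℤ → ℂ := fun k =>
    ((Real.sin (π * |(k:ℝ)| / σ) * Real.exp (-(|(k:ℝ)| * s) / σ) : ℝ) : ℂ) *
      Complex.exp (-Complex.I * ((k:ℝ) * θ / σ : ℝ)) with hf
  have ha : 0 < s / σ := div_pos hs hσ
  have hpos := hasSum_sin_mul_exp_mul_cexp ha (π / σ) (θ / σ)
  have hneg := hasSum_sin_mul_exp_mul_cexp ha (π / σ) (-(θ / σ))
  have f_nat (n : ℕ) : f n = ((Real.sin (n * (π / σ)) * Real.exp (-(n * (s / σ))) : ℝ) : ℂ) *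
      Complex.exp (-Complex.I * ((n * (θ / σ) : ℝ) : ℂ)) := by
    simp only [hf, Int.cast_natCast, Nat.abs_cast]
    ring_nf
  have f_neg (n : ℕ) : f (-n) = ((Real.sin (n * (π / σ)) * Real.exp (-(n * (s / σ))) : ℝ) : ℂ) *
      Complex.exp (-Complex.I * ((n * (-(θ / σ)) : ℝ) : ℂ)) := by
    simp only [hf, Int.cast_neg, abs_neg, Int.cast_natCast, Nat.abs_cast]
    ring_nf
  simp only [← f_nat] at hpos
  simp only [← f_neg] at hneg
  have h := hpos.of_nat_of_neg hneg
  refine ⟨h.summable, h.tsum_eq.trans ?_⟩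
  have f_zero : f 0 = 0 := by simp [hf]
  have e₁ := inv_one_sub_exp_sub_inv_one_sub_exp ha ((π - θ) / σ)
  have e₂ := inv_one_sub_exp_sub_inv_one_sub_exp ha ((π + θ) / σ)
  rw [Asig, Complex.ofReal_add, ← e₁, ← e₂, f_zero,
    show π / σ - θ / σ = (π - θ) / σ by ring, show -(π / σ + θ / σ) = -((π + θ) / σ) by ring,
    show π / σ - -(θ / σ) = (π + θ) / σ by ring,
    show -(π / σ + -(θ / σ)) = -((π - θ) / σ) by ring]
  ring
end
end

section
/- For every σ > 0 there exists a constant C = C(σ) such that for all θ ∈ ℝ, ∫_0^∞ |sin θ| / (cosh(s/σ) − cos θ) ds ≤ C; in particular the bound is uniform in θ. -/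
open MeasureTheory Real Set
open scoped ENNReal

lemma one_add_half_sq_le_cosh {x : ℝ} (hx : 0 ≤ x) : 1 + x ^ 2 / 2 ≤ Real.cosh x := by
  have h1 : x / 2 ≤ Real.sinh (x / 2) := Real.self_le_sinh_iff.2 (by linarith)
  have h2 : Real.cosh x = 1 + 2 * Real.sinh (x / 2) ^ 2 := by
    have := Real.cosh_two_mul (x / 2)
    rw [mul_div_cancel₀ x two_ne_zero, Real.cosh_sq] at this
    linarith
  nlinarith

lemma lintegral_Ioi_lorentzian {σ k : ℝ} (hσ : 0 < σ) (hk : 0 < k) :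
    ∫⁻ s in Ioi (0 : ℝ), ENNReal.ofReal (2 * k / (k ^ 2 + (s / σ) ^ 2)) =
      ENNReal.ofReal (π * σ) := by
  have hderiv : ∀ s ∈ Ici (0 : ℝ), HasDerivAt (fun s => 2 * σ * Real.arctan (s / (σ * k)))
      (2 * k / (k ^ 2 + (s / σ) ^ 2)) s := by
    intro s _
    refine ((((hasDerivAt_id s).div_const (σ * k)).arctan).const_mul (2 * σ)).congr_deriv ?_
    rw [id]
    field_simp
  have hpos : ∀ s ∈ Ioi (0 : ℝ), 0 ≤ 2 * k / (k ^ 2 + (s / σ) ^ 2) := fun s _ => by positivity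
  have hlim : Filter.Tendsto (fun s => 2 * σ * Real.arctan (s / (σ * k))) Filter.atTop
      (nhds (2 * σ * (π / 2))) :=
    ((Real.tendsto_arctan_atTop.mono_right nhdsWithin_le_nhds).comp
      (Filter.tendsto_id.atTop_div_const (mul_pos hσ hk))).const_mul _
  rw [← ofReal_integral_eq_lintegral_ofReal (integrableOn_Ioi_deriv_of_nonneg' hderiv hpos hlim)
    ((ae_restrict_iff' measurableSet_Ioi).2 (.of_forall hpos)),
    integral_Ioi_of_hasDerivAt_of_nonneg' hderiv hpos hlim]
  congr 1
  simp
  ring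

/-- for every `σ > 0` there is a constant `C` such that
`∫_0^∞ |sin θ| / (cosh(s/σ) − cos θ) ds ≤ C` uniformly in `θ ∈ ℝ`. -/
theorem diffractive_density_uniform_bound (σ : ℝ) (hσ : 0 < σ) :
    ∃ C : ℝ, ∀ θ : ℝ,
      (∫⁻ s in Set.Ioi (0:ℝ),
          ENNReal.ofReal (|Real.sin θ| / (Real.cosh (s/σ) - Real.cos θ)))
        ≤ ENNReal.ofReal C := by
  refine ⟨π * σ, fun θ => ?_⟩
  have hsin := Real.sin_sq_add_cos_sq θ
  rcases (Real.cos_le_one θ).eq_or_lt with h | h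
  · have h0 : Real.sin θ = 0 := by
      rw [h] at hsin
      exact pow_eq_zero_iff two_ne_zero |>.1 (by linarith)
    simp [h0]
  set k := √(2 * (1 - Real.cos θ))
  have hk : 0 < k := Real.sqrt_pos.2 (by linarith)
  have hk2 : k ^ 2 = 2 * (1 - Real.cos θ) := Real.sq_sqrt (by linarith)
  have hsk : |Real.sin θ| ≤ k := abs_le_of_sq_le_sq (by nlinarith) hk.le
  rw [← lintegral_Ioi_lorentzian hσ hk]
  refine setLIntegral_mono' measurableSet_Ioi fun s hs => ENNReal.ofReal_le_ofReal ?_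
  have hc := one_add_half_sq_le_cosh (div_pos (mem_Ioi.1 hs) hσ).le
  calc |Real.sin θ| / (Real.cosh (s / σ) - Real.cos θ)
      ≤ k / ((k ^ 2 + (s / σ) ^ 2) / 2) :=
        div_le_div₀ hk.le hsk (by positivity) (by linarith)
    _ = 2 * k / (k ^ 2 + (s / σ) ^ 2) := by rw [div_div_eq_mul_div, mul_comm]
end

section
/- Let 1 ≤ p ≤ ∞. There exists a constant C such that for every measurable f : (0,∞) → ℂ, ( ∫_0^∞ | ∫_0^∞ f(r₂) (1 + r₁ + r₂)^{-3} r₂ dr₂ |^p r₁ dr₁ )^{1/p} ≤ C ( ∫_0^∞ |f(r)|^p r dr )^{1/p}, with the usual essential-supremum interpretation when p = ∞. -/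
open MeasureTheory Real Set
open scoped ENNReal NNReal

noncomputable section

/-- Schur's test for a subunital kernel: integrating out either variable gives at most `1`. -/
theorem eLpNorm_le_of_schur {α E F : Type*} [MeasurableSpace α] [NormedAddCommGroup E]
    [NormedAddCommGroup F] [MeasurableSpace E] [OpensMeasurableSpace E]
    [SecondCountableTopology E] {μ : Measure α} [SFinite μ]
    {K : α → α → ℝ≥0∞} (hK : Measurable (Function.uncurry K))
    (hK₁ : ∀ᵐ x ∂μ, ∫⁻ y, K x y ∂μ ≤ 1) (hK₂ : ∀ᵐ y ∂μ, ∫⁻ x, K x y ∂μ ≤ 1)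
    {f : α → E} (hf : Measurable f) {g : α → F}
    (hg : ∀ᵐ x ∂μ, ‖g x‖ₑ ≤ ∫⁻ y, K x y * ‖f y‖ₑ ∂μ) {p : ℝ≥0∞} (hp : 1 ≤ p) :
    eLpNorm g p μ ≤ eLpNorm f p μ := by
  have hKx (x : α) : Measurable (K x) := hK.of_uncurry_left
  have hpt : ∀ᵐ x ∂μ, ‖g x‖ₑ ≤ eLpNorm f p (μ.withDensity (K x)) := by
    filter_upwards [hK₁, hg] with x hx hgx
    have hmass : (μ.withDensity (K x)) univ ≤ 1 := by
      rwa [withDensity_apply _ MeasurableSet.univ, Measure.restrict_univ]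
    calc ‖g x‖ₑ ≤ ∫⁻ y, K x y * ‖f y‖ₑ ∂μ := hgx
      _ = eLpNorm f 1 (μ.withDensity (K x)) := by
        rw [eLpNorm_one_eq_lintegral_enorm,
          lintegral_withDensity_eq_lintegral_mul _ (hKx x) hf.enorm]
        rfl
      _ ≤ eLpNorm f p (μ.withDensity (K x)) *
          (μ.withDensity (K x)) univ ^ (1 / (1 : ℝ≥0∞).toReal - 1 / p.toReal) :=
        eLpNorm_le_eLpNorm_mul_rpow_measure_univ hp hf.aestronglyMeasurable
      _ ≤ eLpNorm f p (μ.withDensity (K x)) * 1 := by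
        gcongr
        refine ENNReal.rpow_le_one hmass ?_
        rcases eq_or_ne p ∞ with rfl | hptop
        · simp
        · have : 1 ≤ p.toReal := by simpa using ENNReal.toReal_mono hptop hp
          simpa using inv_le_one_of_one_le₀ this
      _ = _ := mul_one _
  rcases eq_or_ne p ∞ with rfl | hptop
  · rw [eLpNorm_exponent_top (f := g)]
    refine essSup_le_of_ae_le _ ?_
    filter_upwards [hpt] with x hx
    refine hx.trans ?_
    rw [eLpNorm_exponent_top, eLpNorm_exponent_top]
    exact eLpNormEssSup_mono_measure f (withDensity_absolutelyContinuous μ (K x))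
  · have hp0 : p ≠ 0 := (zero_lt_one.trans_le hp).ne'
    have hpr : 0 < p.toReal := ENNReal.toReal_pos hp0 hptop
    have hfp : Measurable fun y => ‖f y‖ₑ ^ p.toReal := hf.enorm.pow_const _
    rw [eLpNorm_eq_lintegral_rpow_enorm_toReal hp0 hptop,
      eLpNorm_eq_lintegral_rpow_enorm_toReal hp0 hptop]
    refine ENNReal.rpow_le_rpow ?_ (by positivity)
    calc ∫⁻ x, ‖g x‖ₑ ^ p.toReal ∂μ
        ≤ ∫⁻ x, ∫⁻ y, K x y * ‖f y‖ₑ ^ p.toReal ∂μ ∂μ := by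
          refine lintegral_mono_ae ?_
          filter_upwards [hpt] with x hx
          refine (ENNReal.rpow_le_rpow hx hpr.le).trans_eq ?_
          rw [eLpNorm_eq_lintegral_rpow_enorm_toReal hp0 hptop, ← ENNReal.rpow_mul,
            one_div_mul_cancel hpr.ne', ENNReal.rpow_one,
            lintegral_withDensity_eq_lintegral_mul _ (hKx x) hfp]
          rfl
      _ = ∫⁻ y, ∫⁻ x, K x y * ‖f y‖ₑ ^ p.toReal ∂μ ∂μ :=
          lintegral_lintegral_swap (hK.mul (hfp.comp measurable_snd)).aemeasurable
      _ ≤ ∫⁻ y, ‖f y‖ₑ ^ p.toReal ∂μ := by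
          refine lintegral_mono_ae ?_
          filter_upwards [hK₂] with y hy
          rw [lintegral_mul_const _ hK.of_uncurry_right]
          exact mul_le_of_le_one_left' hy

instance : SFinite radialMeasure := by
  unfold radialMeasure
  infer_instance

theorem ae_radialMeasure_pos : ∀ᵐ r ∂radialMeasure, 0 < r :=
  (withDensity_absolutelyContinuous _ _).ae_le (ae_restrict_mem measurableSet_Ioi)

theorem lintegral_radialMeasure {g : ℝ → ℝ≥0∞} (hg : Measurable g) :
    ∫⁻ r, g r ∂radialMeasure = ∫⁻ r in Ioi (0:ℝ), ENNReal.ofReal r * g r := by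
  rw [radialMeasure, lintegral_withDensity_eq_lintegral_mul _ ENNReal.measurable_ofReal hg]
  rfl

theorem lintegral_Ioi_inv_one_add_sq :
    ∫⁻ s in Ioi (0:ℝ), ENNReal.ofReal (((1 + s) ^ 2)⁻¹) = 1 := by
  have hderiv : ∀ s ∈ Ici (0:ℝ), HasDerivAt (fun s => -(1 + s)⁻¹) (((1 + s) ^ 2)⁻¹) s := by
    intro s hs
    have hs' : (1 + s) ≠ 0 := by have := mem_Ici.1 hs; positivity
    have h : HasDerivAt (fun s => -(1 + s)⁻¹) (-(-1 / (1 + s) ^ 2)) s :=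
      (((hasDerivAt_id s).const_add 1).inv hs').neg
    simpa [neg_div] using h
  have hnonneg : ∀ s ∈ Ioi (0:ℝ), 0 ≤ ((1 + s) ^ 2)⁻¹ := fun s _ => by positivity
  have hlim : Filter.Tendsto (fun s : ℝ => -(1 + s)⁻¹) Filter.atTop (nhds 0) := by
    simpa using (tendsto_inv_atTop_zero.comp
      (Filter.tendsto_atTop_add_const_left _ (1:ℝ) Filter.tendsto_id)).neg
  rw [← ofReal_integral_eq_lintegral_ofReal
    (integrableOn_Ioi_deriv_of_nonneg' hderiv hnonneg hlim)
    (ae_restrict_of_forall_mem measurableSet_Ioi hnonneg),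
    integral_Ioi_of_hasDerivAt_of_nonneg' hderiv hnonneg hlim]
  simp

theorem lintegral_radialMeasure_kernel_le_one {r : ℝ} (hr : 0 < r) :
    ∫⁻ s, ENNReal.ofReal ((1 + r + s) ^ (-(3:ℝ))) ∂radialMeasure ≤ 1 := by
  rw [lintegral_radialMeasure (by fun_prop), ← lintegral_Ioi_inv_one_add_sq]
  refine setLIntegral_mono (by fun_prop) fun s hs => ?_
  have hs : 0 < s := hs
  rw [← ENNReal.ofReal_mul hs.le]
  refine ENNReal.ofReal_le_ofReal ?_
  rw [Real.rpow_neg (by positivity), ← div_eq_mul_inv, div_le_iff₀ (by positivity),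
    ← div_eq_inv_mul, le_div_iff₀ (by positivity)]
  norm_cast
  calc s * (1 + s) ^ 2 ≤ (1 + s) * (1 + s) ^ 2 := by gcongr; linarith
    _ = (1 + s) ^ 3 := by ring
    _ ≤ (1 + r + s) ^ 3 := by gcongr; linarith

/-- for `1 ≤ p ≤ ∞`, the operator with kernel `(1 + r₁ + r₂)^{-3}` is
bounded on `L^p((0,∞), r dr)`. -/
theorem young_radial (p : ℝ≥0∞) (hp : 1 ≤ p) :
    ∃ C : ℝ, 0 < C ∧ ∀ f : ℝ → ℂ, Measurable f →
      eLpNorm (fun r₁ : ℝ =>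
          ∫ r₂ in Set.Ioi (0:ℝ), f r₂ * (((1 + r₁ + r₂) ^ (-(3:ℝ)) : ℝ) : ℂ) * (r₂:ℂ))
        p radialMeasure
        ≤ ENNReal.ofReal C * eLpNorm f p radialMeasure := by
  refine ⟨1, one_pos, fun f hf => ?_⟩
  rw [ENNReal.ofReal_one, one_mul]
  refine eLpNorm_le_of_schur (K := fun r s => ENNReal.ofReal ((1 + r + s) ^ (-(3:ℝ))))
    (by unfold Function.uncurry; fun_prop) ?_ ?_ hf ?_ hp
  · filter_upwards [ae_radialMeasure_pos] with r hr
    exact lintegral_radialMeasure_kernel_le_one hr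
  · filter_upwards [ae_radialMeasure_pos] with s hs
    simpa only [add_right_comm] using lintegral_radialMeasure_kernel_le_one hs
  · filter_upwards [ae_radialMeasure_pos] with r hr
    refine (enorm_integral_le_lintegral_enorm _).trans_eq ?_
    rw [lintegral_radialMeasure (by fun_prop)]
    refine setLIntegral_congr_fun measurableSet_Ioi fun s hs => ?_
    have hs : 0 < s := hs
    have hK : 0 ≤ (1 + r + s) ^ (-(3:ℝ)) := by positivity
    have enorm_ofReal {x : ℝ} (hx : 0 ≤ x) : ‖(x : ℂ)‖ₑ = ENNReal.ofReal x := by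
      rw [← ofReal_norm, Complex.norm_of_nonneg hx]
    simp only [enorm_mul]
    rw [enorm_ofReal hK, enorm_ofReal hs.le]
    ring
end
end

section
/- There exist ε₀ > 0 and, for any family of constants (C_N), a constant C such that the following holds for every ε ∈ (0, ε₀]. Let b : (0,∞) → ℂ be smooth, supported in [3/4, 8/3], with |b^{(N)}(r)| ≤ C_N for all N ≥ 0, and let η be smooth with |η| ≤ C₀ and |η'| ≤ C₀. Then for every λ ≥ 1, every ζ ∈ ℝ, and all r₁, r₂ > 0 with 3/4 ≤ r₁ + r₂ ≤ 8/3: | ∫_{π−2ε}^{π} e^{i ζ θ + i λ d(r₁,r₂;θ)} b(d(r₁,r₂;θ)) η(θ) dθ | ≤ C (λ r₁ r₂)^{-1/2}, where d(r₁,r₂;θ) = sqrt(r₁² + r₂² − 2 r₁ r₂ cos θ). -/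
open MeasureTheory Real Set
open scoped ENNReal NNReal

noncomputable section

/-- Euclidean distance in polar coordinates. -/
def ddist (r₁ r₂ θ : ℝ) : ℝ := Real.sqrt (r₁^2 + r₂^2 - 2*r₁*r₂*Real.cos θ)

/-- First-derivative van der Corput estimate for a convex phase. -/
theorem norm_integral_exp_le_of_le_deriv {φ φ' φ'' : ℝ → ℝ} {a b ν : ℝ} (hab : a ≤ b)
    (hφ : ∀ x ∈ Icc a b, HasDerivAt φ (φ' x) x) (hφ' : ∀ x ∈ Icc a b, HasDerivAt φ' (φ'' x) x)
    (hc : ContinuousOn φ'' (Icc a b)) (hν : 0 < ν) (h1 : ∀ x ∈ Icc a b, ν ≤ φ' x)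
    (h2 : ∀ x ∈ Icc a b, 0 ≤ φ'' x) :
    ‖∫ x in a..b, Complex.exp (Complex.I * (φ x : ℂ))‖ ≤ 2 / ν := by
  have hpos : ∀ x ∈ Icc a b, 0 < φ' x := fun x hx => hν.trans_le (h1 x hx)
  have hne : ∀ x ∈ Icc a b, Complex.I * (φ' x : ℂ) ≠ 0 := fun x hx =>
    mul_ne_zero Complex.I_ne_zero (Complex.ofReal_ne_zero.2 (hpos x hx).ne')
  have hcφ : ContinuousOn φ (Icc a b) := fun x hx => (hφ x hx).continuousAt.continuousWithinAt
  have hcφ' : ContinuousOn φ' (Icc a b) := fun x hx => (hφ' x hx).continuousAt.continuousWithinAt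
  have hinv : ∀ x ∈ Icc a b, (φ' x)⁻¹ ≤ ν⁻¹ := fun x hx => inv_anti₀ hν (h1 x hx)
  have ha : a ∈ Icc a b := left_mem_Icc.2 hab
  have hb : b ∈ Icc a b := right_mem_Icc.2 hab
  have hreal : ∫ x in a..b, φ'' x / φ' x ^ 2 = (φ' a)⁻¹ - (φ' b)⁻¹ := by
    rw [intervalIntegral.integral_eq_sub_of_hasDerivAt (f := fun x => -(φ' x)⁻¹)]
    · ring
    · intro x hx
      rw [uIcc_of_le hab] at hx
      exact ((hφ' x hx).inv (hpos x hx).ne').neg.congr_deriv (by rw [neg_div, neg_neg])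
    · apply ContinuousOn.intervalIntegrable
      rw [uIcc_of_le hab]
      exact hc.div (hcφ'.pow 2) fun x hx => pow_ne_zero 2 (hpos x hx).ne'
  have hparts := intervalIntegral.integral_mul_deriv_eq_deriv_mul (a := a) (b := b)
    (u := fun x => (Complex.I * (φ' x : ℂ))⁻¹) (v := fun x => Complex.exp (Complex.I * (φ x : ℂ)))
    (u' := fun x => -(Complex.I * (φ'' x : ℂ)) / (Complex.I * (φ' x : ℂ)) ^ 2)
    (v' := fun x => Complex.exp (Complex.I * (φ x : ℂ)) * (Complex.I * (φ' x : ℂ)))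
    (fun x hx => by
      rw [uIcc_of_le hab] at hx
      exact ((hφ' x hx).ofReal_comp.const_mul Complex.I).inv (hne x hx))
    (fun x hx => by
      rw [uIcc_of_le hab] at hx
      exact ((hφ x hx).ofReal_comp.const_mul Complex.I).cexp)
    (by
      apply ContinuousOn.intervalIntegrable
      rw [uIcc_of_le hab]
      refine ContinuousOn.div ?_ ?_ fun x hx => pow_ne_zero 2 (hne x hx)
      · fun_prop
      · fun_prop)
    (by
      apply ContinuousOn.intervalIntegrable
      rw [uIcc_of_le hab]
      fun_prop)
  have hlhs : ∫ x in a..b, Complex.exp (Complex.I * (φ x : ℂ)) =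
      ∫ x in a..b, (Complex.I * (φ' x : ℂ))⁻¹ *
        (Complex.exp (Complex.I * (φ x : ℂ)) * (Complex.I * (φ' x : ℂ))) := by
    apply intervalIntegral.integral_congr
    intro x hx
    rw [uIcc_of_le hab] at hx
    exact (inv_mul_cancel_right₀ (hne x hx) _).symm.trans (by ring)
  have hbdry : ∀ x ∈ Icc a b,
      ‖(Complex.I * (φ' x : ℂ))⁻¹ * Complex.exp (Complex.I * (φ x : ℂ))‖ = (φ' x)⁻¹ := by
    intro x hx
    rw [norm_mul, Complex.norm_exp_I_mul_ofReal, norm_inv, norm_mul, Complex.norm_I,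
      Complex.norm_real, Real.norm_of_nonneg (hpos x hx).le]
    ring
  have hint : ‖∫ x in a..b, -(Complex.I * (φ'' x : ℂ)) / (Complex.I * (φ' x : ℂ)) ^ 2 *
      Complex.exp (Complex.I * (φ x : ℂ))‖ ≤ ∫ x in a..b, φ'' x / φ' x ^ 2 := by
    apply intervalIntegral.norm_integral_le_of_norm_le hab
    · refine Filter.Eventually.of_forall fun x hx => ?_
      have hx' := Ioc_subset_Icc_self hx
      rw [norm_mul, Complex.norm_exp_I_mul_ofReal, norm_div, norm_neg, norm_pow, norm_mul,
        norm_mul, Complex.norm_I, Complex.norm_real, Complex.norm_real,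
        Real.norm_of_nonneg (hpos x hx').le, Real.norm_of_nonneg (h2 x hx')]
      simp
    · apply ContinuousOn.intervalIntegrable
      rw [uIcc_of_le hab]
      exact hc.div (hcφ'.pow 2) fun x hx => pow_ne_zero 2 (hpos x hx).ne'
  rw [hlhs, hparts]
  refine (norm_sub_le _ _).trans ((add_le_add (norm_sub_le _ _) hint).trans ?_)
  rw [hbdry a ha, hbdry b hb, hreal, div_eq_mul_inv]
  linarith [hinv a ha]

theorem norm_integral_exp_le_sub {φ : ℝ → ℝ} {a b : ℝ} (hab : a ≤ b) :
    ‖∫ x in a..b, Complex.exp (Complex.I * (φ x : ℂ))‖ ≤ b - a := by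
  have := intervalIntegral.norm_integral_le_of_norm_le_const (a := a) (b := b) (C := 1)
    (f := fun x => Complex.exp (Complex.I * (φ x : ℂ)))
    fun x _ => (Complex.norm_exp_I_mul_ofReal _).le
  rwa [one_mul, abs_of_nonneg (sub_nonneg.2 hab)] at this

theorem intervalIntegrable_exp_I_mul {φ : ℝ → ℝ} {a b : ℝ} (hab : a ≤ b)
    (hφ : ContinuousOn φ (Icc a b)) :
    IntervalIntegrable (fun x => Complex.exp (Complex.I * (φ x : ℂ))) volume a b := by
  apply ContinuousOn.intervalIntegrable
  rw [uIcc_of_le hab]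
  fun_prop

/-- Second-derivative van der Corput estimate for a convex phase that increases on the interval. -/
theorem norm_integral_exp_le_of_deriv_left_nonneg {φ φ' φ'' : ℝ → ℝ} {a b μ : ℝ} (hab : a ≤ b)
    (hφ : ∀ x ∈ Icc a b, HasDerivAt φ (φ' x) x) (hφ' : ∀ x ∈ Icc a b, HasDerivAt φ' (φ'' x) x)
    (hc : ContinuousOn φ'' (Icc a b)) (hμ : 0 < μ) (h2 : ∀ x ∈ Icc a b, μ ≤ φ'' x)
    (ha : 0 ≤ φ' a) :
    ‖∫ x in a..b, Complex.exp (Complex.I * (φ x : ℂ))‖ ≤ 3 * μ ^ (-(1 / 2) : ℝ) := by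
  set δ := μ ^ (-(1 / 2) : ℝ) with hδ
  have hδ0 : 0 < δ := rpow_pos_of_pos hμ _
  have hδμ : μ * δ * δ = 1 := by
    rw [mul_assoc, hδ, ← rpow_add hμ]
    norm_num
    rw [rpow_neg_one, mul_inv_cancel₀ hμ.ne']
  rcases le_total (b - a) δ with h | h
  · exact (norm_integral_exp_le_sub hab).trans (by linarith)
  have hcφ : ContinuousOn φ (Icc a b) := fun x hx => (hφ x hx).continuousAt.continuousWithinAt
  have h_left : Icc a (a + δ) ⊆ Icc a b := Icc_subset_Icc_right (by linarith)
  have h_right : Icc (a + δ) b ⊆ Icc a b := Icc_subset_Icc_left (by linarith)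
  have hgrow : ∀ x ∈ Icc a b, μ * (x - a) ≤ φ' x - φ' a := fun x hx =>
    (convex_Icc a b).mul_sub_le_image_sub_of_le_deriv
      (fun y hy => (hφ' y hy).continuousAt.continuousWithinAt)
      (fun y hy => (hφ' y (interior_subset hy)).differentiableAt.differentiableWithinAt)
      (fun y hy => (hφ' y (interior_subset hy)).deriv ▸ h2 y (interior_subset hy))
      a (left_mem_Icc.2 hab) x hx hx.1
  have htail := norm_integral_exp_le_of_le_deriv (ν := μ * δ) (by linarith : a + δ ≤ b)
    (fun x hx => hφ x (h_right hx)) (fun x hx => hφ' x (h_right hx)) (hc.mono h_right)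
    (mul_pos hμ hδ0)
    (fun x hx => by
      have := hgrow x (h_right hx)
      have := mul_le_mul_of_nonneg_left (by linarith [hx.1] : δ ≤ x - a) hμ.le
      linarith)
    (fun x hx => hμ.le.trans (h2 x (h_right hx)))
  rw [← intervalIntegral.integral_add_adjacent_intervals
    (intervalIntegrable_exp_I_mul (by linarith) (hcφ.mono h_left))
    (intervalIntegrable_exp_I_mul (by linarith) (hcφ.mono h_right))]
  have hhead := norm_integral_exp_le_sub (φ := φ) (by linarith : a ≤ a + δ)
  have h3 : 2 / (μ * δ) = 2 * δ := by
    rw [div_eq_iff (mul_pos hμ hδ0).ne']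
    linarith
  exact (norm_add_le _ _).trans (by linarith)

/-- Second-derivative van der Corput estimate for a convex phase that decreases on the interval. -/
theorem norm_integral_exp_le_of_deriv_right_nonpos {φ φ' φ'' : ℝ → ℝ} {a b μ : ℝ} (hab : a ≤ b)
    (hφ : ∀ x ∈ Icc a b, HasDerivAt φ (φ' x) x) (hφ' : ∀ x ∈ Icc a b, HasDerivAt φ' (φ'' x) x)
    (hc : ContinuousOn φ'' (Icc a b)) (hμ : 0 < μ) (h2 : ∀ x ∈ Icc a b, μ ≤ φ'' x)
    (hb : φ' b ≤ 0) :
    ‖∫ x in a..b, Complex.exp (Complex.I * (φ x : ℂ))‖ ≤ 3 * μ ^ (-(1 / 2) : ℝ) := by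
  have hmem : ∀ x ∈ Icc (-b) (-a), -x ∈ Icc a b := fun x hx =>
    ⟨by linarith [hx.2], by linarith [hx.1]⟩
  have := norm_integral_exp_le_of_deriv_left_nonneg (φ := fun x => φ (-x))
    (φ' := fun x => -φ' (-x)) (φ'' := fun x => φ'' (-x)) (neg_le_neg hab)
    (fun x hx => ((hφ _ (hmem x hx)).comp x (hasDerivAt_neg x)).congr_deriv (by simp))
    (fun x hx => ((hφ' _ (hmem x hx)).comp x (hasDerivAt_neg x)).neg.congr_deriv (by simp))
    (hc.comp continuous_neg.continuousOn hmem) hμ (fun x hx => h2 _ (hmem x hx))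
    (by simpa using hb)
  rwa [intervalIntegral.integral_comp_neg (fun x => Complex.exp (Complex.I * (φ x : ℂ))),
    neg_neg, neg_neg] at this

/-- **Van der Corput's lemma** for a phase with second derivative at least `μ`. -/
theorem norm_integral_exp_le_of_le_deriv_two {φ φ' φ'' : ℝ → ℝ} {a b μ : ℝ} (hab : a ≤ b)
    (hφ : ∀ x ∈ Icc a b, HasDerivAt φ (φ' x) x) (hφ' : ∀ x ∈ Icc a b, HasDerivAt φ' (φ'' x) x)
    (hc : ContinuousOn φ'' (Icc a b)) (hμ : 0 < μ) (h2 : ∀ x ∈ Icc a b, μ ≤ φ'' x) :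
    ‖∫ x in a..b, Complex.exp (Complex.I * (φ x : ℂ))‖ ≤ 6 * μ ^ (-(1 / 2) : ℝ) := by
  have hpos : 0 < μ ^ (-(1 / 2) : ℝ) := rpow_pos_of_pos hμ _
  rcases le_total 0 (φ' a) with ha | ha
  · exact (norm_integral_exp_le_of_deriv_left_nonneg hab hφ hφ' hc hμ h2 ha).trans (by linarith)
  rcases le_total (φ' b) 0 with hb | hb
  · exact (norm_integral_exp_le_of_deriv_right_nonpos hab hφ hφ' hc hμ h2 hb).trans (by linarith)
  obtain ⟨c, hcab, hc0⟩ := intermediate_value_Icc hab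
    (fun x hx => (hφ' x hx).continuousAt.continuousWithinAt) ⟨ha, hb⟩
  have hcφ : ContinuousOn φ (Icc a b) := fun x hx => (hφ x hx).continuousAt.continuousWithinAt
  have h_left : Icc a c ⊆ Icc a b := Icc_subset_Icc_right hcab.2
  have h_right : Icc c b ⊆ Icc a b := Icc_subset_Icc_left hcab.1
  rw [← intervalIntegral.integral_add_adjacent_intervals
    (intervalIntegrable_exp_I_mul hcab.1 (hcφ.mono h_left))
    (intervalIntegrable_exp_I_mul hcab.2 (hcφ.mono h_right))]
  have hl := norm_integral_exp_le_of_deriv_right_nonpos hcab.1 (fun x hx => hφ x (h_left hx))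
    (fun x hx => hφ' x (h_left hx)) (hc.mono h_left) hμ (fun x hx => h2 x (h_left hx)) hc0.le
  have hr := norm_integral_exp_le_of_deriv_left_nonneg hcab.2 (fun x hx => hφ x (h_right hx))
    (fun x hx => hφ' x (h_right hx)) (hc.mono h_right) hμ (fun x hx => h2 x (h_right hx)) hc0.ge
  exact (norm_add_le _ _).trans (by linarith)

theorem norm_integral_exp_neg (φ : ℝ → ℝ) (a b : ℝ) :
    ‖∫ x in a..b, Complex.exp (Complex.I * ((-φ x : ℝ) : ℂ))‖ =
      ‖∫ x in a..b, Complex.exp (Complex.I * (φ x : ℂ))‖ := by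
  rw [intervalIntegral.norm_intervalIntegral_eq, intervalIntegral.norm_intervalIntegral_eq,
    ← RCLike.norm_conj, ← integral_conj]
  simp [← Complex.exp_conj]

/-- Passing from bounds on the primitive of `f` to a bound on the integral of `f * g`. -/
theorem norm_integral_mul_le_of_norm_primitive_le {f g g' : ℝ → ℂ} {a b M A B : ℝ} (hab : a ≤ b)
    (hf : ContinuousOn f (Icc a b)) (hg : ∀ x ∈ Icc a b, HasDerivAt g (g' x) x)
    (hg' : IntervalIntegrable g' volume a b)
    (hF : ∀ x ∈ Icc a b, ‖∫ t in a..x, f t‖ ≤ M) (hA : ∀ x ∈ Icc a b, ‖g x‖ ≤ A)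
    (hB : ∀ x ∈ Icc a b, ‖g' x‖ ≤ B) :
    ‖∫ x in a..b, f x * g x‖ ≤ M * (A + B * (b - a)) := by
  have hfi : IntervalIntegrable f volume a b :=
    ContinuousOn.intervalIntegrable (by rwa [uIcc_of_le hab])
  have hparts := intervalIntegral.integral_mul_deriv_eq_deriv_mul_of_hasDerivAt (a := a) (b := b)
    (u := g) (u' := g') (v := fun x => ∫ t in a..x, f t) (v' := f)
    (fun x hx => (hg x (by rwa [uIcc_of_le hab] at hx)).continuousAt.continuousWithinAt)
    (intervalIntegral.continuousOn_primitive_interval' hfi left_mem_uIcc)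
    (fun x hx => hg x (by
      rw [min_eq_left hab, max_eq_right hab] at hx
      exact Ioo_subset_Icc_self hx))
    (fun x hx => by
      rw [min_eq_left hab, max_eq_right hab] at hx
      refine intervalIntegral.integral_hasDerivAt_right
        (hfi.mono_set ?_) ?_ (hf.continuousAt (Icc_mem_nhds hx.1 hx.2))
      · rw [uIcc_of_le hab, uIcc_of_le hx.1.le]
        exact Icc_subset_Icc_right hx.2.le
      · exact (hf.mono Ioo_subset_Icc_self).stronglyMeasurableAtFilter isOpen_Ioo x hx)
    hg' hfi
  have hint : ‖∫ x in a..b, g' x * ∫ t in a..x, f t‖ ≤ B * M * |b - a| := by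
    apply intervalIntegral.norm_integral_le_of_norm_le_const
    intro x hx
    rw [uIoc_of_le hab] at hx
    have hx' := Ioc_subset_Icc_self hx
    rw [norm_mul]
    exact mul_le_mul (hB x hx') (hF x hx') (norm_nonneg _) ((norm_nonneg _).trans (hB x hx'))
  have hb : b ∈ Icc a b := right_mem_Icc.2 hab
  have hbdry : ‖g b * ∫ t in a..b, f t‖ ≤ A * M := by
    rw [norm_mul]
    exact mul_le_mul (hA b hb) (hF b hb) (norm_nonneg _) ((norm_nonneg _).trans (hA b hb))
  simp_rw [mul_comm (f _)]
  rw [hparts, intervalIntegral.integral_same, mul_zero, sub_zero]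
  rw [abs_of_nonneg (sub_nonneg.2 hab)] at hint
  exact (norm_sub_le _ _).trans (by linarith)

theorem ddist_sq_lower_bound {r₁ r₂ θ : ℝ} (h₁ : 0 < r₁) (h₂ : 0 < r₂) (hθ : cos θ ≤ -(1 / 2)) :
    r₁ ^ 2 + r₂ ^ 2 + r₁ * r₂ ≤ r₁ ^ 2 + r₂ ^ 2 - 2 * r₁ * r₂ * cos θ := by
  nlinarith [mul_pos h₁ h₂]

theorem ddist_pos {r₁ r₂ θ : ℝ} (h₁ : 0 < r₁) (h₂ : 0 < r₂) (hθ : cos θ ≤ -(1 / 2)) :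
    0 < ddist r₁ r₂ θ :=
  Real.sqrt_pos.2 (lt_of_lt_of_le (by positivity) (ddist_sq_lower_bound h₁ h₂ hθ))

theorem mul_le_ddist_sq {r₁ r₂ θ : ℝ} (h₁ : 0 < r₁) (h₂ : 0 < r₂) (hθ : cos θ ≤ -(1 / 2)) :
    r₁ * r₂ ≤ ddist r₁ r₂ θ ^ 2 := by
  have h := ddist_sq_lower_bound h₁ h₂ hθ
  rw [ddist, Real.sq_sqrt (le_trans (by positivity) h)]
  nlinarith [sq_nonneg r₁, sq_nonneg r₂]

theorem ddist_le_add {r₁ r₂ : ℝ} (θ : ℝ) (h₁ : 0 < r₁) (h₂ : 0 < r₂) :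
    ddist r₁ r₂ θ ≤ r₁ + r₂ :=
  Real.sqrt_le_iff.2 ⟨by positivity, by nlinarith [mul_pos h₁ h₂, neg_one_le_cos θ]⟩

theorem hasDerivAt_ddist {r₁ r₂ θ : ℝ} (h : 0 < ddist r₁ r₂ θ) :
    HasDerivAt (ddist r₁ r₂) (r₁ * r₂ * sin θ / ddist r₁ r₂ θ) θ := by
  have h1 : HasDerivAt (fun t => r₁ ^ 2 + r₂ ^ 2 - 2 * r₁ * r₂ * cos t)
      (-(2 * r₁ * r₂ * -sin θ)) θ :=
    ((hasDerivAt_cos θ).const_mul (2 * r₁ * r₂)).const_sub _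
  refine (h1.sqrt (Real.sqrt_pos.1 h).ne').congr_deriv ?_
  change -(2 * r₁ * r₂ * -sin θ) / (2 * ddist r₁ r₂ θ) = _
  field_simp

theorem hasDerivAt_deriv_ddist {r₁ r₂ θ : ℝ} (h : 0 < ddist r₁ r₂ θ) :
    HasDerivAt (fun t => r₁ * r₂ * sin t / ddist r₁ r₂ t)
      (r₁ * r₂ * cos θ / ddist r₁ r₂ θ - (r₁ * r₂ * sin θ) ^ 2 / ddist r₁ r₂ θ ^ 3) θ := by
  refine (((hasDerivAt_sin θ).const_mul (r₁ * r₂)).div (hasDerivAt_ddist h) h.ne').congr_deriv ?_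
  field_simp

theorem continuous_ddist (r₁ r₂ : ℝ) : Continuous (ddist r₁ r₂) := by
  unfold ddist
  fun_prop

theorem abs_deriv_ddist_le {r₁ r₂ θ : ℝ} (h₁ : 0 < r₁) (h₂ : 0 < r₂) (hθ : cos θ ≤ -(1 / 2)) :
    |r₁ * r₂ * sin θ / ddist r₁ r₂ θ| ≤ r₁ + r₂ := by
  have hd := ddist_pos h₁ h₂ hθ
  rw [abs_div, abs_of_pos hd, abs_mul, abs_of_pos (mul_pos h₁ h₂), div_le_iff₀ hd]
  calc r₁ * r₂ * |sin θ| ≤ r₁ * r₂ * 1 := by gcongr; exact abs_sin_le_one θ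
    _ ≤ ddist r₁ r₂ θ * ddist r₁ r₂ θ := by linarith [mul_le_ddist_sq h₁ h₂ hθ]
    _ ≤ (r₁ + r₂) * ddist r₁ r₂ θ := by gcongr; exact ddist_le_add θ h₁ h₂

theorem deriv_two_ddist_le {r₁ r₂ θ : ℝ} (h₁ : 0 < r₁) (h₂ : 0 < r₂) (hθ : cos θ ≤ -(1 / 2)) :
    r₁ * r₂ * cos θ / ddist r₁ r₂ θ - (r₁ * r₂ * sin θ) ^ 2 / ddist r₁ r₂ θ ^ 3 ≤
      -(r₁ * r₂ / (2 * (r₁ + r₂))) := by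
  have hd := ddist_pos h₁ h₂ hθ
  have hpos := mul_pos h₁ h₂
  have hsq : 0 ≤ (r₁ * r₂ * sin θ) ^ 2 / ddist r₁ r₂ θ ^ 3 := by positivity
  have hcos : r₁ * r₂ * cos θ / ddist r₁ r₂ θ ≤ -(r₁ * r₂ / (2 * ddist r₁ r₂ θ)) := by
    rw [div_le_iff₀ hd]
    field_simp
    linarith
  have hle : r₁ * r₂ / (2 * (r₁ + r₂)) ≤ r₁ * r₂ / (2 * ddist r₁ r₂ θ) := by
    gcongr
    exact ddist_le_add θ h₁ h₂
  linarith

theorem cos_le_neg_half {θ : ℝ} (h₁ : π - 1 ≤ θ) (h₂ : θ ≤ π) : cos θ ≤ -(1 / 2) := by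
  have h := cos_le_cos_of_nonneg_of_le_pi (sub_nonneg.2 h₂) (by linarith [pi_pos] : π / 3 ≤ π)
    (by linarith [pi_gt_three])
  rw [cos_pi_div_three, cos_pi_sub] at h
  linarith

/-- the uniform van der Corput / Fourier-multiplier bound
`|∫_{π−2ε}^π e^{i(ζθ + λ d)} b(d) η(θ) dθ| ≤ C (λ r₁ r₂)^{-1/2}`. -/
theorem multiplier_van_der_corput_bound :
    ∃ ε₀ : ℝ, 0 < ε₀ ∧ ∀ (CN : ℕ → ℝ) (C₀ : ℝ),
    ∃ C : ℝ, 0 < C ∧ ∀ ε : ℝ, 0 < ε → ε ≤ ε₀ →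
    ∀ b : ℝ → ℂ, ContDiff ℝ (⊤ : ℕ∞) b → Function.support b ⊆ Set.Icc (3/4) (8/3) →
      (∀ N : ℕ, ∀ r : ℝ, ‖iteratedDeriv N b r‖ ≤ CN N) →
    ∀ η : ℝ → ℂ, Differentiable ℝ η → (∀ t, ‖η t‖ ≤ C₀) → (∀ t, ‖deriv η t‖ ≤ C₀) →
    ∀ lam ζ r₁ r₂ : ℝ, 1 ≤ lam → 0 < r₁ → 0 < r₂ →
      3/4 ≤ r₁ + r₂ → r₁ + r₂ ≤ 8/3 →
      ‖∫ θ in (π - 2*ε)..π,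
          Complex.exp (Complex.I * ((ζ*θ + lam * ddist r₁ r₂ θ : ℝ) : ℂ)) *
            b (ddist r₁ r₂ θ) * η θ‖
        ≤ C * (lam * r₁ * r₂) ^ (-(1/2) : ℝ) := by
  refine ⟨1 / 2, by norm_num, fun CN C₀ => ⟨6 * (3 / 16 : ℝ) ^ (-(1 / 2) : ℝ) *
    (|CN 0| * |C₀| + (|CN 1| * (8 / 3) * |C₀| + |CN 0| * |C₀|)) + 1, by positivity, ?_⟩⟩
  intro ε hε hε' b hb _ hbN η hη hηC hηC' lam ζ r₁ r₂ hlam h₁ h₂ _ hr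
  have hlam0 : 0 < lam := by linarith
  have hab : π - 2 * ε ≤ π := by linarith
  have hcos : ∀ x ∈ Icc (π - 2 * ε) π, cos x ≤ -(1 / 2) := fun x hx =>
    cos_le_neg_half (by linarith [hx.1]) hx.2
  have hd : ∀ x ∈ Icc (π - 2 * ε) π, 0 < ddist r₁ r₂ x := fun x hx => ddist_pos h₁ h₂ (hcos x hx)
  have hdc := continuous_ddist r₁ r₂
  have hd'c : ContinuousOn (fun x => r₁ * r₂ * sin x / ddist r₁ r₂ x) (Icc (π - 2 * ε) π) :=
    ContinuousOn.div (by fun_prop) hdc.continuousOn fun x hx => (hd x hx).ne'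
  have hμ : 0 < 3 / 16 * (lam * r₁ * r₂) := by positivity
  have hosc : ∀ x ∈ Icc (π - 2 * ε) π,
      ‖∫ t in (π - 2 * ε)..x, Complex.exp (Complex.I * ((ζ * t + lam * ddist r₁ r₂ t : ℝ) : ℂ))‖
        ≤ 6 * (3 / 16 * (lam * r₁ * r₂)) ^ (-(1 / 2) : ℝ) := by
    intro x hx
    have hsub : Icc (π - 2 * ε) x ⊆ Icc (π - 2 * ε) π := Icc_subset_Icc_right hx.2
    rw [← norm_integral_exp_neg]
    refine norm_integral_exp_le_of_le_deriv_two hx.1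
      (φ' := fun t => -(ζ + lam * (r₁ * r₂ * sin t / ddist r₁ r₂ t)))
      (φ'' := fun t => -(lam * (r₁ * r₂ * cos t / ddist r₁ r₂ t -
        (r₁ * r₂ * sin t) ^ 2 / ddist r₁ r₂ t ^ 3)))
      (fun t ht => ?_) (fun t ht => ?_) ?_ hμ (fun t ht => ?_)
    · exact (((hasDerivAt_id t).const_mul ζ).add
        ((hasDerivAt_ddist (hd t (hsub ht))).const_mul lam)).neg.congr_deriv (by simp)
    · exact (((hasDerivAt_deriv_ddist (hd t (hsub ht))).const_mul lam).const_add ζ).neg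
    · refine (continuousOn_const.mul (ContinuousOn.sub ?_ ?_)).neg
      · exact ContinuousOn.div (by fun_prop) hdc.continuousOn fun t ht => (hd t (hsub ht)).ne'
      · exact ContinuousOn.div (by fun_prop) (hdc.pow 3).continuousOn
          fun t ht => pow_ne_zero 3 (hd t (hsub ht)).ne'
    · have hle : 3 / 16 * (r₁ * r₂) ≤ r₁ * r₂ / (2 * (r₁ + r₂)) := by
        rw [le_div_iff₀ (by positivity)]
        nlinarith [mul_pos h₁ h₂]
      have := mul_le_mul_of_nonneg_left
        (hle.trans (le_neg_of_le_neg (deriv_two_ddist_le h₁ h₂ (hcos t (hsub ht))))) hlam0.le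
      linarith
  have hb0 : ∀ r, ‖b r‖ ≤ |CN 0| := fun r => by
    simpa using (hbN 0 r).trans (le_abs_self _)
  have hb1 : ∀ r, ‖deriv b r‖ ≤ |CN 1| := fun r => by
    simpa [iteratedDeriv_one] using (hbN 1 r).trans (le_abs_self _)
  have hη0 : ∀ t, ‖η t‖ ≤ |C₀| := fun t => (hηC t).trans (le_abs_self _)
  have hη1 : ∀ t, ‖deriv η t‖ ≤ |C₀| := fun t => (hηC' t).trans (le_abs_self _)
  have hbd : Differentiable ℝ b := hb.differentiable (by simp)
  have hb'c : Continuous (deriv b) := hb.continuous_deriv (by exact_mod_cast le_top)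
  have hη'int : IntervalIntegrable (deriv η) volume (π - 2 * ε) π :=
    (intervalIntegrable_const (c := |C₀|)).mono_fun (measurable_deriv η).aestronglyMeasurable
      (Filter.Eventually.of_forall fun t => by simpa using hη1 t)
  have key := norm_integral_mul_le_of_norm_primitive_le hab
    (f := fun θ => Complex.exp (Complex.I * ((ζ * θ + lam * ddist r₁ r₂ θ : ℝ) : ℂ)))
    (g := fun θ => b (ddist r₁ r₂ θ) * η θ)
    (g' := fun θ => ((r₁ * r₂ * sin θ / ddist r₁ r₂ θ) • deriv b (ddist r₁ r₂ θ)) * η θ +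
      b (ddist r₁ r₂ θ) * deriv η θ)
    (A := |CN 0| * |C₀|) (B := |CN 1| * (8 / 3) * |C₀| + |CN 0| * |C₀|)
    (by fun_prop)
    (fun x hx => ((hbd _).hasDerivAt.scomp x (hasDerivAt_ddist (hd x hx))).mul (hη x).hasDerivAt)
    (by
      refine IntervalIntegrable.add ?_ (hη'int.continuousOn_mul ?_)
      · apply ContinuousOn.intervalIntegrable
        rw [uIcc_of_le hab]
        exact (hd'c.smul (hb'c.comp hdc).continuousOn).mul hη.continuous.continuousOn
      · exact (hb.continuous.comp hdc).continuousOn)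
    hosc
    (fun x _ => by
      rw [norm_mul]
      exact mul_le_mul (hb0 _) (hη0 _) (norm_nonneg _) (abs_nonneg _))
    (fun x hx => by
      refine (norm_add_le _ _).trans ?_
      rw [norm_mul, norm_mul, norm_smul, mul_comm ‖_‖ ‖deriv b _‖]
      gcongr
      · exact hb1 _
      · exact (abs_deriv_ddist_le h₁ h₂ (hcos x hx)).trans hr
      · exact hη0 _
      · exact hb0 _
      · exact hη1 _)
  simp_rw [mul_assoc (Complex.exp _)]
  refine key.trans ?_
  rw [mul_rpow (by norm_num) (by positivity)]
  set P := (lam * r₁ * r₂) ^ (-(1 / 2) : ℝ)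
  have hP : 0 ≤ P := by positivity
  calc 6 * ((3 / 16 : ℝ) ^ (-(1 / 2) : ℝ) * P) *
        (|CN 0| * |C₀| + (|CN 1| * (8 / 3) * |C₀| + |CN 0| * |C₀|) * (π - (π - 2 * ε)))
      ≤ 6 * ((3 / 16 : ℝ) ^ (-(1 / 2) : ℝ) * P) *
        (|CN 0| * |C₀| + (|CN 1| * (8 / 3) * |C₀| + |CN 0| * |C₀|) * 1) := by
        gcongr
        linarith
    _ ≤ _ := by linarith
end
end

section
/- Let σ > 1, δ > 0, and let a be a symbol of order 0 with constants (C_n). There exists a constant C such that for every integer k ≥ 1, all r₁, r₂ > 0 with 3/4 ≤ r₁ + r₂ ≤ 8/3, and all θ ∈ ℝ: | ∫_{2σ}^∞ e^{i 2^k d_s} a(2^k d_s) (2^{-k} + d_s)^{-(3/2+δ)} A_σ(s, θ) ds | ≤ C (1 + 2^k r₁ r₂)^{-1/2}, where d_s = d_s(r₁,r₂). -/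
open MeasureTheory Real Set
open scoped ENNReal NNReal

noncomputable section

/-- Non-stationary phase: one integration by parts on a half-line. -/
theorem norm_integral_Ioi_exp_mul_deriv_le {φ φ' w : ℝ → ℝ} {H H' : ℝ → ℂ} {c t : ℝ} (ht : 0 < t)
    (hφ : ∀ s ∈ Ici c, HasDerivAt φ (φ' s) s) (hH : ∀ s ∈ Ici c, HasDerivAt H (H' s) s)
    (hw : IntegrableOn w (Ioi c)) (hHw : ∀ s ∈ Ioi c, ‖H' s‖ ≤ w s)
    (hlim : Filter.Tendsto H Filter.atTop (nhds 0)) :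
    ‖∫ s in Ioi c, Complex.exp (Complex.I * ((t * φ s : ℝ) : ℂ)) * ((φ' s : ℂ) * H s)‖
      ≤ (‖H c‖ + ∫ s in Ioi c, w s) / t := by
  set e : ℝ → ℂ := fun s => Complex.exp (Complex.I * ((t * φ s : ℝ) : ℂ)) with he
  have hen : ∀ s, ‖e s‖ = 1 := fun s => by
    rw [he]
    simp only
    rw [mul_comm, Complex.norm_exp_ofReal_mul_I]
  have hwn : 0 ≤ ∫ s in Ioi c, w s :=
    setIntegral_nonneg measurableSet_Ioi fun s hs => (norm_nonneg _).trans (hHw s hs)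
  by_cases hG : IntegrableOn (fun s => e s * ((φ' s : ℂ) * H s)) (Ioi c)
  swap
  · rw [integral_undef hG, norm_zero]
    positivity
  have hde : ∀ s ∈ Ici c, HasDerivAt e (e s * (Complex.I * ((t * φ' s : ℝ) : ℂ))) s :=
    fun s hs => ((((hφ s hs).const_mul t).ofReal_comp).const_mul Complex.I).cexp
  have hemeas : AEStronglyMeasurable e (volume.restrict (Ioi c)) :=
    ContinuousOn.aestronglyMeasurable
      (fun s hs => (hde s (mem_Ici_of_Ioi hs)).continuousAt.continuousWithinAt) measurableSet_Ioi
  have hH'meas : AEStronglyMeasurable H' (volume.restrict (Ioi c)) := by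
    refine (stronglyMeasurable_deriv H).aestronglyMeasurable.congr ?_
    filter_upwards [ae_restrict_mem measurableSet_Ioi] with s hs
    exact (hH s (mem_Ici_of_Ioi hs)).deriv
  have hle : ∀ s ∈ Ioi c, ‖e s * H' s‖ ≤ w s := fun s hs => by
    rw [norm_mul, hen, one_mul]
    exact hHw s hs
  have hint : IntegrableOn (fun s => e s * H' s) (Ioi c) :=
    Integrable.mono' hw (hemeas.mul hH'meas)
      ((ae_restrict_mem measurableSet_Ioi).mono hle)
  have hlim' : Filter.Tendsto (fun s => e s * H s) Filter.atTop (nhds 0) := by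
    rw [tendsto_zero_iff_norm_tendsto_zero] at hlim ⊢
    simpa [hen] using hlim
  have key := integral_Ioi_of_hasDerivAt_of_tendsto'
    (f := fun s => e s * H s)
    (f' := fun s => (Complex.I * t) * (e s * ((φ' s : ℂ) * H s)) + e s * H' s)
    (fun s hs => by
      refine ((hde s hs).mul (hH s hs)).congr_deriv ?_
      push_cast
      ring) ((hG.const_mul _).add hint) hlim'
  rw [integral_add (hG.const_mul _) hint, integral_const_mul] at key
  have hkey : (Complex.I * t) * ∫ s in Ioi c, e s * ((φ' s : ℂ) * H s)
      = -(e c * H c) - ∫ s in Ioi c, e s * H' s := by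
    linear_combination key
  rw [le_div_iff₀ ht]
  calc ‖∫ s in Ioi c, e s * ((φ' s : ℂ) * H s)‖ * t
      = ‖(Complex.I * t) * ∫ s in Ioi c, e s * ((φ' s : ℂ) * H s)‖ := by
        rw [norm_mul, norm_mul, Complex.norm_I, Complex.norm_real, Real.norm_of_nonneg ht.le]
        ring
    _ ≤ ‖e c * H c‖ + ‖∫ s in Ioi c, e s * H' s‖ := by
        rw [hkey]
        exact (norm_sub_le _ _).trans_eq (by rw [norm_neg])
    _ ≤ ‖H c‖ + ∫ s in Ioi c, w s := by
        gcongr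
        · rw [norm_mul, hen, one_mul]
        · exact norm_integral_le_of_norm_le hw ((ae_restrict_mem measurableSet_Ioi).mono hle)

/-- The derivative in `s` of `Asig σ s θ`. -/
def asigDeriv (σ s θ : ℝ) : ℝ :=
  (1/2) * (-(Real.sin ((π - θ)/σ) * (Real.sinh (s/σ) * (1/σ)))
    / (Real.cosh (s/σ) - Real.cos ((π - θ)/σ))^2)
  + (1/2) * (-(Real.sin ((π + θ)/σ) * (Real.sinh (s/σ) * (1/σ)))
    / (Real.cosh (s/σ) - Real.cos ((π + θ)/σ))^2)

theorem exp_le_four_mul_cosh_sub {x y : ℝ} (hx : 2 ≤ x) (hy : y ≤ 1) :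
    Real.exp x ≤ 4 * (Real.cosh x - y) := by
  have h2 : (4:ℝ) ≤ Real.exp x := by
    have h1 : (2:ℝ) ≤ Real.exp 1 := by linarith [Real.add_one_le_exp (1:ℝ)]
    calc (4:ℝ) ≤ Real.exp 1 * Real.exp 1 := by nlinarith
      _ = Real.exp 2 := by rw [← Real.exp_add]; norm_num
      _ ≤ Real.exp x := Real.exp_le_exp.2 hx
  rw [Real.cosh_eq]
  linarith [Real.exp_pos (-x)]

theorem abs_div_cosh_sub_le {x y n : ℝ} (hx : 2 ≤ x) (hy : y ≤ 1) (hn : |n| ≤ 1) :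
    |n / (Real.cosh x - y)| ≤ 4 * Real.exp (-x) := by
  have h := exp_le_four_mul_cosh_sub hx hy
  have hD : 0 < Real.cosh x - y := by linarith [Real.exp_pos x]
  rw [abs_div, abs_of_pos hD, div_le_iff₀ hD]
  have h1 : Real.exp (-x) * Real.exp x = 1 := by rw [← Real.exp_add]; simp
  nlinarith [Real.exp_pos (-x)]

theorem abs_sinh_div_cosh_sub_sq_le {x y n m : ℝ} (hx : 2 ≤ x) (hy : y ≤ 1) (hn : |n| ≤ 1)
    (hm0 : 0 ≤ m) (hm1 : m ≤ 1) :
    |-(n * (Real.sinh x * m)) / (Real.cosh x - y)^2| ≤ 8 * Real.exp (-x) := by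
  have h := exp_le_four_mul_cosh_sub hx hy
  have hD : 0 < Real.cosh x - y := by linarith [Real.exp_pos x]
  have h1 : Real.exp (-x) * Real.exp x = 1 := by rw [← Real.exp_add]; simp
  have hs0 : 0 ≤ Real.sinh x := Real.sinh_nonneg_iff.2 (by linarith)
  have hs : Real.sinh x ≤ Real.exp x / 2 := by
    rw [Real.sinh_eq]; linarith [Real.exp_pos (-x)]
  rw [abs_div, abs_neg, abs_mul, abs_mul, abs_of_nonneg hs0, abs_of_nonneg hm0,
    abs_of_pos (pow_pos hD 2), div_le_iff₀ (pow_pos hD 2)]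
  have h3 : Real.exp x ^ 2 ≤ 16 * (Real.cosh x - y)^2 := by nlinarith [Real.exp_pos x]
  have h4 : Real.sinh x * m ≤ Real.sinh x := mul_le_of_le_one_right hs0 hm1
  calc |n| * (Real.sinh x * m) ≤ 1 * Real.sinh x := by gcongr
    _ ≤ (Real.exp (-x) * Real.exp x) * Real.exp x / 2 := by rw [h1]; linarith
    _ = (Real.exp (-x) / 2) * Real.exp x ^ 2 := by ring
    _ ≤ (Real.exp (-x) / 2) * (16 * (Real.cosh x - y)^2) := by gcongr
    _ = _ := by ring

theorem abs_asig_le {σ s θ : ℝ} (hσ : 1 < σ) (hs : 2 * σ ≤ s) :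
    |Asig σ s θ| ≤ 4 * Real.exp (-(s/σ)) := by
  have hx : 2 ≤ s / σ := by rwa [le_div_iff₀ (by linarith)]
  have h1 := abs_div_cosh_sub_le hx (Real.cos_le_one ((π - θ)/σ)) (Real.abs_sin_le_one ((π - θ)/σ))
  have h2 := abs_div_cosh_sub_le hx (Real.cos_le_one ((π + θ)/σ)) (Real.abs_sin_le_one ((π + θ)/σ))
  rw [Asig]
  rw [abs_le] at *
  constructor <;> linarith

theorem abs_asigDeriv_le {σ s θ : ℝ} (hσ : 1 < σ) (hs : 2 * σ ≤ s) :
    |asigDeriv σ s θ| ≤ 8 * Real.exp (-(s/σ)) := by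
  have hx : 2 ≤ s / σ := by rwa [le_div_iff₀ (by linarith)]
  have hm0 : 0 ≤ 1 / σ := by positivity
  have hm1 : 1 / σ ≤ 1 := by rw [div_le_one (by linarith)]; exact hσ.le
  have h1 := abs_sinh_div_cosh_sub_sq_le hx (Real.cos_le_one ((π - θ)/σ))
    (Real.abs_sin_le_one ((π - θ)/σ)) hm0 hm1
  have h2 := abs_sinh_div_cosh_sub_sq_le hx (Real.cos_le_one ((π + θ)/σ))
    (Real.abs_sin_le_one ((π + θ)/σ)) hm0 hm1
  rw [asigDeriv]
  rw [abs_le] at *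
  constructor <;> linarith

theorem hasDerivAt_asig {σ s θ : ℝ} (hσ : 1 < σ) (hs : 2 * σ ≤ s) :
    HasDerivAt (fun s => Asig σ s θ) (asigDeriv σ s θ) s := by
  have hx : 2 ≤ s / σ := by rwa [le_div_iff₀ (by linarith)]
  have aux : ∀ α : ℝ, HasDerivAt
      (fun s => Real.sin α / (Real.cosh (s/σ) - Real.cos α))
      (-(Real.sin α * (Real.sinh (s/σ) * (1/σ))) / (Real.cosh (s/σ) - Real.cos α)^2) s := by
    intro α
    have hD : Real.cosh (s/σ) - Real.cos α ≠ 0 := by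
      linarith [Real.exp_pos (s/σ), exp_le_four_mul_cosh_sub hx (Real.cos_le_one α)]
    refine ((hasDerivAt_const s (Real.sin α)).div
      ((((hasDerivAt_id s).div_const σ).cosh).sub_const (Real.cos α)) hD).congr_deriv ?_
    simp
  exact ((aux _).const_mul _).add ((aux _).const_mul _)

theorem two_le_sinh {s : ℝ} (hs : 2 ≤ s) : 2 ≤ Real.sinh s :=
  hs.trans (Real.self_le_sinh_iff.2 (by linarith))

theorem sq_dsc_pos {s r₁ r₂ : ℝ} (h₁ : 0 < r₁) (h₂ : 0 < r₂) :
    0 < r₁^2 + r₂^2 + 2*r₁*r₂*Real.cosh s := by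
  have := Real.cosh_pos s
  positivity

theorem add_le_dsc (s : ℝ) {r₁ r₂ : ℝ} (h₁ : 0 < r₁) (h₂ : 0 < r₂) : r₁ + r₂ ≤ dsc s r₁ r₂ := by
  apply Real.le_sqrt_of_sq_le
  nlinarith [Real.one_le_cosh s, mul_pos h₁ h₂]

theorem hasDerivAt_dsc (s : ℝ) {r₁ r₂ : ℝ} (h₁ : 0 < r₁) (h₂ : 0 < r₂) :
    HasDerivAt (fun s => dsc s r₁ r₂) (r₁ * r₂ * Real.sinh s / dsc s r₁ r₂) s := by
  refine ((((Real.hasDerivAt_cosh s).const_mul (2*r₁*r₂)).const_add (r₁^2 + r₂^2)).sqrt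
    (sq_dsc_pos h₁ h₂).ne').congr_deriv ?_
  rw [dsc]
  have := Real.sqrt_pos.2 (sq_dsc_pos (s := s) h₁ h₂)
  field_simp

/-- The derivative in `s` of `Asig σ s θ / sinh s`. -/
def asigDivSinhDeriv (σ s θ : ℝ) : ℝ :=
  (asigDeriv σ s θ * Real.sinh s - Asig σ s θ * Real.cosh s) / Real.sinh s ^ 2

theorem hasDerivAt_asig_div_sinh {σ s θ : ℝ} (hσ : 1 < σ) (hs : 2 * σ ≤ s) :
    HasDerivAt (fun s => Asig σ s θ / Real.sinh s) (asigDivSinhDeriv σ s θ) s :=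
  (hasDerivAt_asig hσ hs).div (Real.hasDerivAt_sinh s)
    (by linarith [two_le_sinh (s := s) (by linarith)])

theorem abs_asigDivSinhDeriv_le {σ s θ : ℝ} (hσ : 1 < σ) (hs : 2 * σ ≤ s) :
    |asigDivSinhDeriv σ s θ| ≤ 12 * Real.exp (-(s/σ)) := by
  have hS := two_le_sinh (s := s) (by linarith)
  have hC : Real.cosh s ≤ Real.sinh s ^ 2 := by
    nlinarith [Real.cosh_sq s, Real.one_le_cosh s]
  have hA := abs_asig_le (θ := θ) hσ hs
  have hA' := abs_asigDeriv_le (θ := θ) hσ hs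
  rw [asigDivSinhDeriv, abs_div, abs_of_pos (by positivity : 0 < Real.sinh s ^ 2),
    div_le_iff₀ (by positivity)]
  calc |asigDeriv σ s θ * Real.sinh s - Asig σ s θ * Real.cosh s|
      ≤ |asigDeriv σ s θ| * Real.sinh s + |Asig σ s θ| * Real.cosh s := by
        refine (abs_sub _ _).trans_eq ?_
        rw [abs_mul, abs_mul, abs_of_nonneg (by linarith : 0 ≤ Real.sinh s), abs_of_pos (Real.cosh_pos s)]
    _ ≤ (8 * Real.exp (-(s/σ))) * Real.sinh s ^ 2 + (4 * Real.exp (-(s/σ))) * Real.sinh s ^ 2 := by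
        gcongr
        nlinarith
    _ = _ := by ring

theorem abs_asig_div_sinh_le {σ s θ : ℝ} (hσ : 1 < σ) (hs : 2 * σ ≤ s) :
    |Asig σ s θ / Real.sinh s| ≤ 4 * Real.exp (-(s/σ)) := by
  have hS := two_le_sinh (s := s) (by linarith)
  rw [abs_div, abs_of_pos (by linarith : 0 < Real.sinh s)]
  exact (div_le_self (abs_nonneg _) (by linarith)).trans (abs_asig_le hσ hs)

theorem integrableOn_exp_neg_div {σ : ℝ} (hσ : 0 < σ) (c : ℝ) :
    IntegrableOn (fun s : ℝ => Real.exp (-(s/σ))) (Ioi c) := by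
  convert integrableOn_exp_mul_Ioi (a := -(1/σ)) (by simpa using hσ) c using 3
  ring

/-- The total mass of `exp (-s/σ)` on `s > 2σ`. -/
def expTail (σ : ℝ) : ℝ := ∫ s in Ioi (2*σ), Real.exp (-(s/σ))

theorem expTail_nonneg (σ : ℝ) : 0 ≤ expTail σ :=
  setIntegral_nonneg measurableSet_Ioi fun _ _ => (Real.exp_pos _).le

section Amplitude

variable {σ r₁ r₂ t M : ℝ} {B B' : ℝ → ℂ}

theorem norm_integral_amplitude_le (hσ : 1 < σ) (h₁ : 0 < r₁) (h₂ : 0 < r₂) (hr : 3/4 ≤ r₁ + r₂)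
    (hB : ∀ u, 3/4 ≤ u → ‖B u‖ ≤ M) (θ : ℝ) :
    ‖∫ s in Ioi (2*σ), Complex.exp (Complex.I * ((t * dsc s r₁ r₂ : ℝ) : ℂ)) *
        (B (dsc s r₁ r₂) * ((Asig σ s θ / dsc s r₁ r₂ : ℝ) : ℂ))‖ ≤ 8 * M * expTail σ := by
  have hM : 0 ≤ M := (norm_nonneg _).trans (hB 1 (by norm_num))
  rw [expTail, ← integral_const_mul]
  refine norm_integral_le_of_norm_le
    ((integrableOn_exp_neg_div (by linarith) _).const_mul _)
    ((ae_restrict_mem measurableSet_Ioi).mono fun s hs => ?_)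
  have hs' : 2 * σ ≤ s := le_of_lt hs
  have hd : 3/4 ≤ dsc s r₁ r₂ := hr.trans (add_le_dsc s h₁ h₂)
  have hd0 : 0 < dsc s r₁ r₂ := by linarith
  rw [norm_mul, norm_mul, mul_comm Complex.I, Complex.norm_exp_ofReal_mul_I, one_mul,
    Complex.norm_real, Real.norm_eq_abs, abs_div, abs_of_pos hd0]
  have hA := abs_asig_le (θ := θ) hσ hs'
  have : |Asig σ s θ| / dsc s r₁ r₂ ≤ 8 * Real.exp (-(s/σ)) := by
    rw [div_le_iff₀ hd0]
    nlinarith [Real.exp_pos (-(s/σ))]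
  calc _ ≤ M * (8 * Real.exp (-(s/σ))) := by
        gcongr
        exact hB _ hd
    _ = _ := by ring

theorem norm_integral_amplitude_le_div (hσ : 1 < σ) (h₁ : 0 < r₁) (h₂ : 0 < r₂)
    (hr : 3/4 ≤ r₁ + r₂) (hr' : r₁ + r₂ ≤ 8/3) (ht : 0 < t)
    (hB : ∀ u, 3/4 ≤ u → ‖B u‖ ≤ M) (hB' : ∀ u, 3/4 ≤ u → ‖B' u‖ ≤ M)
    (hBd : ∀ u, 3/4 ≤ u → HasDerivAt B (B' u) u) (θ : ℝ) :
    ‖∫ s in Ioi (2*σ), Complex.exp (Complex.I * ((t * dsc s r₁ r₂ : ℝ) : ℂ)) *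
        (B (dsc s r₁ r₂) * ((Asig σ s θ / dsc s r₁ r₂ : ℝ) : ℂ))‖ * (t * r₁ * r₂)
      ≤ 4 * M + 28 * M * expTail σ := by
  have hM : 0 ≤ M := (norm_nonneg _).trans (hB 1 (by norm_num))
  have hσ0 : 0 < σ := by linarith
  have hp : 0 < r₁ * r₂ := mul_pos h₁ h₂
  have hp2 : r₁ * r₂ ≤ 2 := by nlinarith [sq_nonneg (r₁ - r₂)]
  have hd (s : ℝ) : 3/4 ≤ dsc s r₁ r₂ := hr.trans (add_le_dsc s h₁ h₂)
  set H : ℝ → ℂ := fun s =>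
    B (dsc s r₁ r₂) * ((Asig σ s θ / Real.sinh s / (r₁ * r₂) : ℝ) : ℂ) with hH
  set H' : ℝ → ℂ := fun s =>
    ((r₁ * r₂ * Real.sinh s / dsc s r₁ r₂ : ℝ) : ℂ) * B' (dsc s r₁ r₂)
        * ((Asig σ s θ / Real.sinh s / (r₁ * r₂) : ℝ) : ℂ)
      + B (dsc s r₁ r₂) * ((asigDivSinhDeriv σ s θ / (r₁ * r₂) : ℝ) : ℂ) with hH'
  have hHd : ∀ s ∈ Ici (2*σ), HasDerivAt H (H' s) s := by
    intro s hs
    have h1 := HasDerivAt.scomp s (hBd _ (hd s)) (hasDerivAt_dsc s h₁ h₂)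
    have h2 := ((hasDerivAt_asig_div_sinh (θ := θ) hσ hs).div_const (r₁ * r₂)).ofReal_comp
    exact h1.mul h2
  have hHn : ∀ s, 2 * σ ≤ s → ‖H s‖ ≤ 4 * M / (r₁ * r₂) * Real.exp (-(s/σ)) := by
    intro s hs
    rw [hH]
    simp only
    rw [norm_mul, Complex.norm_real, Real.norm_eq_abs, abs_div _ (r₁ * r₂), abs_of_pos hp]
    calc _ ≤ M * (4 * Real.exp (-(s/σ)) / (r₁ * r₂)) := by
          gcongr
          · exact hB _ (hd s)
          · exact abs_asig_div_sinh_le hσ hs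
      _ = _ := by ring
  have hH'n : ∀ s ∈ Ioi (2*σ), ‖H' s‖ ≤ 28 * M / (r₁ * r₂) * Real.exp (-(s/σ)) := by
    intro s hs
    have hs' : 2 * σ ≤ s := le_of_lt hs
    have hd0 : 0 < dsc s r₁ r₂ := by linarith [hd s]
    have hS := two_le_sinh (s := s) (by linarith)
    have e1 : ((r₁ * r₂ * Real.sinh s / dsc s r₁ r₂ : ℝ) : ℂ) * B' (dsc s r₁ r₂)
        * ((Asig σ s θ / Real.sinh s / (r₁ * r₂) : ℝ) : ℂ)
        = B' (dsc s r₁ r₂) * ((Asig σ s θ / dsc s r₁ r₂ : ℝ) : ℂ) := by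
      rw [mul_comm _ (B' _), mul_assoc, ← Complex.ofReal_mul]
      congr 2
      field_simp
    have hA := abs_asig_le (θ := θ) hσ hs'
    have hE := abs_asigDivSinhDeriv_le (θ := θ) hσ hs'
    have hx := Real.exp_pos (-(s/σ))
    have b1 : |Asig σ s θ| / dsc s r₁ r₂ ≤ 16 * Real.exp (-(s/σ)) / (r₁ * r₂) := by
      rw [div_le_div_iff₀ hd0 hp]
      calc |Asig σ s θ| * (r₁ * r₂) ≤ (4 * Real.exp (-(s/σ))) * 2 := by gcongr
        _ ≤ _ := by nlinarith [hd s]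
    rw [hH']
    simp only
    rw [e1]
    refine (norm_add_le _ _).trans ?_
    rw [norm_mul, norm_mul, Complex.norm_real, Complex.norm_real, Real.norm_eq_abs,
      Real.norm_eq_abs, abs_div, abs_div, abs_of_pos hp, abs_of_pos hd0]
    calc _ ≤ M * (16 * Real.exp (-(s/σ)) / (r₁ * r₂))
          + M * (12 * Real.exp (-(s/σ)) / (r₁ * r₂)) := by
          gcongr
          · exact hB' _ (hd s)
          · exact hB _ (hd s)
      _ = _ := by ring
  have hlim : Filter.Tendsto H Filter.atTop (nhds 0) := by
    refine squeeze_zero_norm' ((Filter.eventually_ge_atTop (2*σ)).mono hHn) ?_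
    have h : Filter.Tendsto (fun s : ℝ => Real.exp (-(s/σ))) Filter.atTop (nhds 0) :=
      Real.tendsto_exp_neg_atTop_nhds_zero.comp (Filter.tendsto_id.atTop_div_const hσ0)
    simpa using h.const_mul (4 * M / (r₁ * r₂))
  have key := norm_integral_Ioi_exp_mul_deriv_le ht (fun s _ => hasDerivAt_dsc s h₁ h₂) hHd
    ((integrableOn_exp_neg_div hσ0 _).const_mul _) hH'n hlim
  have hHc : ‖H (2*σ)‖ ≤ 4 * M / (r₁ * r₂) :=
    (hHn _ le_rfl).trans (mul_le_of_le_one_right (by positivity)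
      (Real.exp_le_one_iff.2 (by rw [neg_nonpos]; positivity)))
  have hcongr : (∫ s in Ioi (2*σ), Complex.exp (Complex.I * ((t * dsc s r₁ r₂ : ℝ) : ℂ)) *
        (B (dsc s r₁ r₂) * ((Asig σ s θ / dsc s r₁ r₂ : ℝ) : ℂ)))
      = ∫ s in Ioi (2*σ), Complex.exp (Complex.I * ((t * dsc s r₁ r₂ : ℝ) : ℂ)) *
        (((r₁ * r₂ * Real.sinh s / dsc s r₁ r₂ : ℝ) : ℂ) * H s) := by
    refine setIntegral_congr_fun measurableSet_Ioi fun s hs => ?_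
    have hs' : 2 * σ < s := hs
    have hS := two_le_sinh (s := s) (by linarith)
    have hd0 : 0 < dsc s r₁ r₂ := by linarith [hd s]
    simp only [hH]
    rw [mul_left_comm (Complex.ofReal _) (B _) (Complex.ofReal _), ← Complex.ofReal_mul]
    congr 3
    field_simp
  rw [integral_const_mul, le_div_iff₀ ht] at key
  rw [hcongr]
  rw [← expTail] at key
  calc _ = (‖∫ s in Ioi (2*σ), Complex.exp (Complex.I * ((t * dsc s r₁ r₂ : ℝ) : ℂ)) *
        (((r₁ * r₂ * Real.sinh s / dsc s r₁ r₂ : ℝ) : ℂ) * H s)‖ * t) * (r₁ * r₂) := by ring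
    _ ≤ (4 * M / (r₁ * r₂) + 28 * M / (r₁ * r₂) * expTail σ) * (r₁ * r₂) := by
        gcongr
        exact key.trans (by gcongr)
    _ = _ := by field_simp

end Amplitude

/-- The radial amplitude `a(tu) (t⁻¹ + u)^(-β) u`. -/
def amplitude (a : ℝ → ℂ) (t β u : ℝ) : ℂ := a (t * u) * (((t⁻¹ + u) ^ (-β) * u : ℝ) : ℂ)

/-- The derivative of the radial amplitude. -/
def amplitudeDeriv (a : ℝ → ℂ) (t β u : ℝ) : ℂ :=
  (t : ℂ) * derivWithin a (Ioi 0) (t * u) * (((t⁻¹ + u) ^ (-β) * u : ℝ) : ℂ)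
    + a (t * u) * (((-β) * (t⁻¹ + u) ^ (-β - 1) * u + (t⁻¹ + u) ^ (-β) : ℝ) : ℂ)

section Symbol

variable {a : ℝ → ℂ} {Cn : ℕ → ℝ} {t β u : ℝ}

theorem IsSymbol0.norm_le (ha : IsSymbol0 a Cn) {r : ℝ} (hr : 0 < r) : ‖a r‖ ≤ Cn 0 := by
  simpa using ha.2 0 r hr

theorem IsSymbol0.norm_derivWithin_le (ha : IsSymbol0 a Cn) {r : ℝ} (hr : 0 < r) :
    ‖derivWithin a (Ioi 0) r‖ ≤ Cn 1 / (1 + r) := by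
  have := ha.2 1 r hr
  rw [iteratedDerivWithin_one, Nat.cast_one, Real.rpow_neg_one] at this
  exact this

theorem IsSymbol0.hasDerivAt (ha : IsSymbol0 a Cn) {r : ℝ} (hr : 0 < r) :
    HasDerivAt a (derivWithin a (Ioi 0) r) r :=
  ((ha.1.differentiableOn (by simp)) r hr).hasDerivWithinAt.hasDerivAt (Ioi_mem_nhds hr)

theorem hasDerivAt_amplitude (ha : IsSymbol0 a Cn) (ht : 0 < t) (hu : 0 < u) :
    HasDerivAt (amplitude a t β) (amplitudeDeriv a t β u) u := by
  have hv : 0 < t⁻¹ + u := by positivity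
  have h1 : HasDerivAt (fun u => a (t * u)) ((t : ℂ) * derivWithin a (Ioi 0) (t * u)) u := by
    have := HasDerivAt.scomp u (ha.hasDerivAt (mul_pos ht hu)) ((hasDerivAt_id u).const_mul t)
    simpa using! this
  have h2 : HasDerivAt (fun u => (t⁻¹ + u) ^ (-β) * u)
      ((-β) * (t⁻¹ + u) ^ (-β - 1) * u + (t⁻¹ + u) ^ (-β)) u := by
    refine ((((hasDerivAt_id u).const_add t⁻¹).rpow_const (p := -β) (Or.inl hv.ne')).mul
      (hasDerivAt_id u)).congr_deriv ?_
    simp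
  exact h1.mul h2.ofReal_comp

theorem rpow_neg_mul_le (ht : 0 < t) (hβ : 1 ≤ β) (hu : 3/4 ≤ u) :
    (t⁻¹ + u) ^ (-β) * u ≤ (3/4 : ℝ) ^ (-β) := by
  have ht' : 0 < t⁻¹ := by positivity
  have hv : 3/4 ≤ t⁻¹ + u := by linarith
  calc (t⁻¹ + u) ^ (-β) * u ≤ (t⁻¹ + u) ^ (-β) * (t⁻¹ + u) := by gcongr; linarith
    _ = (t⁻¹ + u) ^ (-β + 1) := by rw [Real.rpow_add_one (by linarith)]
    _ ≤ (3/4 : ℝ) ^ (-β + 1) := Real.rpow_le_rpow_of_nonpos (by norm_num) hv (by linarith)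
    _ = (3/4 : ℝ) ^ (-β) * (3/4) := Real.rpow_add_one (by norm_num) _
    _ ≤ (3/4 : ℝ) ^ (-β) := mul_le_of_le_one_right (by positivity) (by norm_num)

/-- A uniform bound for the radial amplitude and its derivative on `u ≥ 3/4`. -/
def amplitudeBound (β C₀ C₁ : ℝ) : ℝ := (C₁ + C₀ * (β + 1)) * (3/4 : ℝ) ^ (-β)

theorem IsSymbol0.const_nonneg (ha : IsSymbol0 a Cn) : 0 ≤ Cn 0 ∧ 0 ≤ Cn 1 := by
  have h0 := (norm_nonneg _).trans (ha.norm_le one_pos)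
  have h1 := (norm_nonneg _).trans (ha.norm_derivWithin_le one_pos)
  exact ⟨h0, by linarith⟩

theorem norm_amplitude_le (ha : IsSymbol0 a Cn) (ht : 0 < t) (hβ : 1 ≤ β) (hu : 3/4 ≤ u) :
    ‖amplitude a t β u‖ ≤ amplitudeBound β (Cn 0) (Cn 1) := by
  obtain ⟨h0, h1⟩ := ha.const_nonneg
  have hu0 : 0 < u := by linarith
  have hv : 0 < t⁻¹ + u := by positivity
  rw [amplitude, amplitudeBound, norm_mul, Complex.norm_real,
    Real.norm_of_nonneg (by positivity)]
  calc _ ≤ Cn 0 * (3/4 : ℝ) ^ (-β) := by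
        gcongr
        · exact ha.norm_le (mul_pos ht hu0)
        · exact rpow_neg_mul_le ht hβ hu
    _ ≤ _ := by
        gcongr
        nlinarith

theorem norm_amplitudeDeriv_le (ha : IsSymbol0 a Cn) (ht : 0 < t) (hβ : 1 ≤ β) (hu : 3/4 ≤ u) :
    ‖amplitudeDeriv a t β u‖ ≤ amplitudeBound β (Cn 0) (Cn 1) := by
  obtain ⟨h0, h1⟩ := ha.const_nonneg
  have hu0 : 0 < u := by linarith
  have hv : 0 < t⁻¹ + u := by positivity
  have ht' : 0 < t⁻¹ := by positivity
  have hT : 0 < (3/4 : ℝ) ^ (-β) := by positivity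
  have hV : (t⁻¹ + u) ^ (-β) ≤ (3/4 : ℝ) ^ (-β) :=
    Real.rpow_le_rpow_of_nonpos (by norm_num) (by linarith) (by linarith)
  have hV0 : 0 < (t⁻¹ + u) ^ (-β) := by positivity
  have hW : (t⁻¹ + u) ^ (-β - 1) * u ≤ (3/4 : ℝ) ^ (-β) := by
    rw [Real.rpow_sub_one hv.ne', div_mul_eq_mul_div, div_le_iff₀ hv]
    exact mul_le_mul hV (by linarith) hu0.le hT.le
  have hW0 : 0 < (t⁻¹ + u) ^ (-β - 1) * u := by positivity
  have b1 : ‖(t : ℂ) * derivWithin a (Ioi 0) (t * u) * (((t⁻¹ + u) ^ (-β) * u : ℝ) : ℂ)‖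
      ≤ Cn 1 * (3/4 : ℝ) ^ (-β) := by
    rw [norm_mul, norm_mul, Complex.norm_real, Complex.norm_real, Real.norm_of_nonneg ht.le,
      Real.norm_of_nonneg (by positivity)]
    calc _ ≤ t * (Cn 1 / (1 + t * u)) * ((t⁻¹ + u) ^ (-β) * u) := by
          gcongr
          exact ha.norm_derivWithin_le (mul_pos ht hu0)
      _ = (Cn 1 * (t⁻¹ + u) ^ (-β)) * ((t * u) / (1 + t * u)) := by ring
      _ ≤ (Cn 1 * (t⁻¹ + u) ^ (-β)) * 1 := by
          gcongr
          rw [div_le_one (by positivity)]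
          linarith
      _ ≤ _ := by rw [mul_one]; gcongr
  have b2 : ‖a (t * u) * (((-β) * (t⁻¹ + u) ^ (-β - 1) * u + (t⁻¹ + u) ^ (-β) : ℝ) : ℂ)‖
      ≤ Cn 0 * ((β + 1) * (3/4 : ℝ) ^ (-β)) := by
    rw [norm_mul, Complex.norm_real]
    gcongr
    · exact ha.norm_le (mul_pos ht hu0)
    · rw [Real.norm_eq_abs, abs_le]
      constructor <;> nlinarith
  rw [amplitudeDeriv, amplitudeBound]
  calc _ ≤ _ := norm_add_le_of_le b1 b2
    _ = _ := by ring

end Symbol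

theorem integrand_eq_amplitude (a : ℝ → ℂ) {t β d : ℝ} (hd : d ≠ 0) (A : ℝ) :
    Complex.exp (Complex.I * ((t * d : ℝ) : ℂ)) * a (t * d) * (((t⁻¹ + d) ^ (-β) : ℝ) : ℂ)
        * (A : ℂ)
      = Complex.exp (Complex.I * ((t * d : ℝ) : ℂ)) *
        (amplitude a t β d * ((A / d : ℝ) : ℂ)) := by
  have hd' : (d : ℂ) ≠ 0 := Complex.ofReal_ne_zero.2 hd
  rw [amplitude]
  push_cast
  field_simp

/-- the oscillatory-integral bound for the diffractive term in the
region `s ≥ 2σ`. -/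
theorem diffractive_large_s_bound (σ δ : ℝ) (hσ : 1 < σ) (hδ : 0 < δ)
    (a : ℝ → ℂ) (Cn : ℕ → ℝ) (ha : IsSymbol0 a Cn) :
    ∃ C : ℝ, 0 < C ∧ ∀ k : ℕ, 1 ≤ k → ∀ r₁ r₂ θ : ℝ, 0 < r₁ → 0 < r₂ →
      3/4 ≤ r₁ + r₂ → r₁ + r₂ ≤ 8/3 →
      ‖∫ s in Set.Ioi (2*σ),
          Complex.exp (Complex.I * (((2:ℝ)^k * dsc s r₁ r₂ : ℝ) : ℂ)) *
            a ((2:ℝ)^k * dsc s r₁ r₂) *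
            ((((2:ℝ) ^ (-(k:ℝ)) + dsc s r₁ r₂) ^ (-(3/2 + δ)) : ℝ) : ℂ) *
            ((Asig σ s θ : ℝ) : ℂ)‖
        ≤ C * (1 + 2^k * r₁ * r₂) ^ (-(1/2) : ℝ) := by
  have hσ0 : 0 < σ := by linarith
  have hβ : 1 ≤ 3/2 + δ := by linarith
  set M := amplitudeBound (3/2 + δ) (Cn 0) (Cn 1)
  have hM : 0 ≤ M := (norm_nonneg _).trans
    (norm_amplitude_le ha one_pos hβ (u := 1) (by norm_num))
  have hW := expTail_nonneg σ
  refine ⟨4 * M + 36 * M * expTail σ + 1, by positivity, ?_⟩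
  intro k _ r₁ r₂ θ h₁ h₂ hr hr'
  have ht : (0:ℝ) < 2 ^ k := by positivity
  have hpow : (2:ℝ) ^ (-(k:ℝ)) = (2 ^ k)⁻¹ := by rw [Real.rpow_neg (by norm_num), Real.rpow_natCast]
  have hd (s : ℝ) : dsc s r₁ r₂ ≠ 0 := by linarith [add_le_dsc s h₁ h₂]
  simp only [hpow, integrand_eq_amplitude a (hd _)]
  have b1 := norm_integral_amplitude_le (t := 2 ^ k) hσ h₁ h₂ hr
    (fun u hu => norm_amplitude_le ha ht hβ hu) θ
  have b2 := norm_integral_amplitude_le_div hσ h₁ h₂ hr hr' ht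
    (fun u hu => norm_amplitude_le ha ht hβ hu) (fun u hu => norm_amplitudeDeriv_le ha ht hβ hu)
    (fun u hu => hasDerivAt_amplitude ha ht (by linarith)) θ
  have hy : (1:ℝ) ≤ 1 + 2 ^ k * r₁ * r₂ := by linarith [mul_pos (mul_pos ht h₁) h₂]
  calc _ ≤ (4 * M + 36 * M * expTail σ + 1) / (1 + 2 ^ k * r₁ * r₂) := by
        rw [le_div_iff₀ (by linarith), mul_add, mul_one]
        linarith
    _ = (4 * M + 36 * M * expTail σ + 1) * (1 + 2 ^ k * r₁ * r₂) ^ (-1 : ℝ) := by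
        rw [Real.rpow_neg_one, div_eq_mul_inv]
    _ ≤ _ := by
        refine mul_le_mul_of_nonneg_left ?_ (by positivity)
        exact Real.rpow_le_rpow_of_exponent_le hy (by norm_num)
end
end

section
/- There exists a constant c > 0 such that for all r₁, r₂ > 0 with 3/4 ≤ r₁ + r₂ ≤ 8/3 and all s ≥ 2, (r₁ r₂ sinh s)/sqrt(r₁² + r₂² + 2 r₁ r₂ cosh s) ≥ c · min( sqrt(r₁ r₂), r₁ r₂ ). -/
open Real

/-- the non-stationarity lower bound
`∂_s d_s ≥ c·min(sqrt(r₁r₂), r₁r₂)` for `s ≥ 2` and `r₁ + r₂ ≍ 1`. -/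
theorem phase_derivative_lower_bound :
    ∃ c : ℝ, 0 < c ∧ ∀ r₁ r₂ s : ℝ, 0 < r₁ → 0 < r₂ →
      3/4 ≤ r₁ + r₂ → r₁ + r₂ ≤ 8/3 → 2 ≤ s →
      c * min (Real.sqrt (r₁*r₂)) (r₁*r₂)
        ≤ r₁*r₂*Real.sinh s / Real.sqrt (r₁^2 + r₂^2 + 2*r₁*r₂*Real.cosh s) := by
  refine ⟨1/2, by norm_num, fun r₁ r₂ s h₁ h₂ _ hsum hs => ?_⟩
  have hp : 0 < r₁ * r₂ := mul_pos h₁ h₂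
  have hsinh : 2 ≤ sinh s := hs.trans (self_le_sinh_iff.2 (by linarith))
  have hcosh_one : 1 ≤ cosh s := one_le_cosh s
  have hsq : cosh s ^ 2 = sinh s ^ 2 + 1 := cosh_sq s
  have hcosh : 2 ≤ cosh s := by nlinarith
  have hsum_sq : (r₁ + r₂) ^ 2 ≤ 64/9 := by nlinarith
  have hprod : r₁ * r₂ ≤ 16/9 := by nlinarith [sq_nonneg (r₁ - r₂)]
  have hdist : r₁^2 + r₂^2 + 2*r₁*r₂*cosh s ≤ (2 * sinh s) ^ 2 := by
    have hmul : r₁ * r₂ * (cosh s - 1) ≤ 16/9 * (cosh s - 1) :=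
      mul_le_mul_of_nonneg_right hprod (by linarith)
    nlinarith
  have hsqrt : √(r₁^2 + r₂^2 + 2*r₁*r₂*cosh s) ≤ 2 * sinh s :=
    sqrt_le_iff.2 ⟨by linarith, hdist⟩
  have hpos : 0 < √(r₁^2 + r₂^2 + 2*r₁*r₂*cosh s) := sqrt_pos.2 (by positivity)
  calc 1/2 * min √(r₁*r₂) (r₁*r₂) ≤ 1/2 * (r₁*r₂) := by gcongr; exact min_le_right _ _
    _ ≤ r₁*r₂*sinh s / √(r₁^2 + r₂^2 + 2*r₁*r₂*cosh s) := by
      rw [le_div_iff₀ hpos]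
      linarith [mul_le_mul_of_nonneg_left hsqrt hp.le]
end

section
/- There exist constants ε > 0 and c > 0 such that for all r₁, r₂ > 0 with 3/4 ≤ r₁ + r₂ ≤ 8/3 and all θ with |θ − π| ≤ ε, the second derivative in θ of the function d(r₁,r₂;θ) = sqrt(r₁² + r₂² − 2 r₁ r₂ cos θ) satisfies | ∂_θ² d(r₁,r₂;θ) | ≥ c r₁ r₂. Moreover ∂_θ d(r₁,r₂;θ) = (r₁ r₂ sin θ)/sqrt(r₁² + r₂² − 2 r₁ r₂ cos θ) and ∂_θ² d(r₁,r₂;θ) = (r₁ r₂ cos θ)/sqrt(r₁² + r₂² − 2 r₁ r₂ cos θ) − (r₁ r₂ sin θ)²/(r₁² + r₂² − 2 r₁ r₂ cos θ)^{3/2}. -/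
open Real

theorem rpow_three_halves_eq_sqrt_pow {x : ℝ} (hx : 0 ≤ x) :
    x ^ ((3:ℝ)/2) = Real.sqrt x ^ 3 := by
  rw [Real.sqrt_eq_rpow, ← Real.rpow_mul_natCast hx]
  norm_num

theorem hasDerivAt_sqrt_law_of_cosines {r₁ r₂ θ : ℝ}
    (h : 0 < r₁^2 + r₂^2 - 2*r₁*r₂*Real.cos θ) :
    HasDerivAt (fun θ : ℝ => Real.sqrt (r₁^2 + r₂^2 - 2*r₁*r₂*Real.cos θ))
      (r₁*r₂*Real.sin θ / Real.sqrt (r₁^2 + r₂^2 - 2*r₁*r₂*Real.cos θ)) θ := by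
  have hd := (((Real.hasDerivAt_cos θ).const_mul (2*r₁*r₂)).const_sub (r₁^2 + r₂^2)).sqrt h.ne'
  refine hd.congr_deriv ?_
  have := Real.sqrt_pos.mpr h
  field_simp

theorem hasDerivAt_deriv_sqrt_law_of_cosines {r₁ r₂ θ : ℝ}
    (h : 0 < r₁^2 + r₂^2 - 2*r₁*r₂*Real.cos θ) :
    HasDerivAt (fun θ : ℝ =>
        r₁*r₂*Real.sin θ / Real.sqrt (r₁^2 + r₂^2 - 2*r₁*r₂*Real.cos θ))
      (r₁*r₂*Real.cos θ / Real.sqrt (r₁^2 + r₂^2 - 2*r₁*r₂*Real.cos θ)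
        - (r₁*r₂*Real.sin θ)^2 / (r₁^2 + r₂^2 - 2*r₁*r₂*Real.cos θ) ^ ((3:ℝ)/2)) θ := by
  have hs := Real.sqrt_pos.mpr h
  have hd := ((Real.hasDerivAt_sin θ).const_mul (r₁*r₂)).div
    (hasDerivAt_sqrt_law_of_cosines h) hs.ne'
  refine hd.congr_deriv ?_
  rw [rpow_three_halves_eq_sqrt_pow h.le]
  field_simp

/-- near `θ = π`, with `r₁ + r₂ ≍ 1`, the distance
`d(r₁,r₂;θ) = sqrt(r₁² + r₂² − 2 r₁ r₂ cos θ)` has the stated first and second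
`θ`-derivatives, and the second derivative is bounded below in absolute value by
`c r₁ r₂`. -/
theorem curvature_lower_bound_near_pi :
    ∃ ε c : ℝ, 0 < ε ∧ 0 < c ∧ ∀ r₁ r₂ : ℝ, 0 < r₁ → 0 < r₂ →
      3/4 ≤ r₁ + r₂ → r₁ + r₂ ≤ 8/3 → ∀ θ : ℝ, |θ - π| ≤ ε →
      (HasDerivAt (fun θ : ℝ => Real.sqrt (r₁^2 + r₂^2 - 2*r₁*r₂*Real.cos θ))
        (r₁*r₂*Real.sin θ / Real.sqrt (r₁^2 + r₂^2 - 2*r₁*r₂*Real.cos θ)) θ) ∧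
      (HasDerivAt (fun θ : ℝ =>
          r₁*r₂*Real.sin θ / Real.sqrt (r₁^2 + r₂^2 - 2*r₁*r₂*Real.cos θ))
        (r₁*r₂*Real.cos θ / Real.sqrt (r₁^2 + r₂^2 - 2*r₁*r₂*Real.cos θ)
          - (r₁*r₂*Real.sin θ)^2 / (r₁^2 + r₂^2 - 2*r₁*r₂*Real.cos θ) ^ ((3:ℝ)/2)) θ) ∧
      c * (r₁*r₂) ≤
        |r₁*r₂*Real.cos θ / Real.sqrt (r₁^2 + r₂^2 - 2*r₁*r₂*Real.cos θ)
          - (r₁*r₂*Real.sin θ)^2 / (r₁^2 + r₂^2 - 2*r₁*r₂*Real.cos θ) ^ ((3:ℝ)/2)| := by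
  refine ⟨1, 3/16, by norm_num, by norm_num, fun r₁ r₂ h₁ h₂ _ hle θ hθ => ?_⟩
  have hP : 0 < r₁ * r₂ := mul_pos h₁ h₂
  have hcos : Real.cos θ ≤ -(1/2) := by
    have hq := Real.one_sub_sq_div_two_le_cos (x := θ - π)
    rw [Real.cos_sub_pi] at hq
    have hsq : (θ - π)^2 ≤ 1 := (sq_le_one_iff_abs_le_one _).mpr hθ
    linarith
  have hD : 0 < r₁^2 + r₂^2 - 2*r₁*r₂*Real.cos θ := by
    nlinarith [sq_nonneg r₁, sq_nonneg r₂]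
  refine ⟨hasDerivAt_sqrt_law_of_cosines hD, hasDerivAt_deriv_sqrt_law_of_cosines hD, ?_⟩
  have hs := Real.sqrt_pos.mpr hD
  have hsle : Real.sqrt (r₁^2 + r₂^2 - 2*r₁*r₂*Real.cos θ) ≤ 8/3 := by
    refine Real.sqrt_le_iff.mpr ⟨by norm_num, ?_⟩
    nlinarith [Real.neg_one_le_cos θ]
  have hsin : 0 ≤ (r₁*r₂*Real.sin θ)^2 /
      (r₁^2 + r₂^2 - 2*r₁*r₂*Real.cos θ) ^ ((3:ℝ)/2) := by positivity
  have hmain : r₁*r₂*Real.cos θ / Real.sqrt (r₁^2 + r₂^2 - 2*r₁*r₂*Real.cos θ)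
      ≤ -(3/16 * (r₁*r₂)) := by
    rw [div_le_iff₀ hs]
    nlinarith [mul_le_mul_of_nonneg_left hsle hP.le, mul_le_mul_of_nonneg_left hcos hP.le]
  exact le_abs.mpr (Or.inr (by linarith))
end
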